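/- arXiv:2303.11382 — 3 statements merged into one kernel-verified Lean document; each statement's English description precedes it below -/
import Mathlib

section
/- Let X = (X_1, …, X_{n_X}) and Y = (Y_1, …, Y_{n_Y}) be projective measurements on ℂ^d, and let C⁽²⁾ be the n_X × n_Y real matrix with entries C⁽²⁾_{ij} = tr(X_i Y_j). Let α, λ, μ be real parameters with 0 < μ ≤ α ≤ 1 and 0 ≤ λ < α. Then for every density matrix ρ on ℂ^d, λ·H(X)_ρ + μ·H(Y)_ρ ≥ α·S(ρ) − α·log ‖C⁽²⁾‖_{(α/μ) → (α/(α−λ))}. -/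
open scoped BigOperators ComplexOrder

/-- The vector `p`-norm of a complex vector, for a real exponent `p`. -/
noncomputable def vecPNorm {n : Type*} [Fintype n] (p : ℝ) (v : n → ℂ) : ℝ :=
  (∑ i, ‖v i‖ ^ p) ^ (1 / p)

/-- The `(r → s)` operator norm of a complex matrix, for real exponents. -/
noncomputable def matPNorm {m n : Type*} [Fintype m] [Fintype n] (r s : ℝ)
    (C : Matrix m n ℂ) : ℝ :=
  sSup {t : ℝ | ∃ φ : n → ℂ, φ ≠ 0 ∧ t = vecPNorm s (C.mulVec φ) / vecPNorm r φ}

/-- Shannon entropy of a finite probability vector (natural log, `0 log 0 = 0`). -/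
noncomputable def shannonEntropy {ι : Type*} [Fintype ι] (p : ι → ℝ) : ℝ :=
  -∑ i, p i * Real.log (p i)

/-- Von Neumann entropy: `-∑ λᵢ log λᵢ` over the eigenvalues of a Hermitian matrix. -/
noncomputable def vonNeumannEntropy {d : ℕ} (ρ : Matrix (Fin d) (Fin d) ℂ) : ℝ :=
  if h : ρ.IsHermitian then -∑ i, h.eigenvalues i * Real.log (h.eigenvalues i) else 0


open Matrix in
theorem eu_quad {d nX nY : ℕ}
    (X : Fin nX → Matrix (Fin d) (Fin d) ℂ) (Y : Fin nY → Matrix (Fin d) (Fin d) ℂ)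
    (hXherm : ∀ i, (X i).IsHermitian) (hXproj : ∀ i, X i * X i = X i)
    (hXsum : ∑ i, X i = 1)
    (hYherm : ∀ j, (Y j).IsHermitian) (hYproj : ∀ j, Y j * Y j = Y j)
    (hYorth : ∀ j k, j ≠ k → Y j * Y k = 0)
    (l : Fin d → ℝ) (hl : ∀ k, 0 ≤ l k) (s : Fin nX → ℝ) (hs : ∀ i, 0 < s i)
    (t : ℝ) (ht : 0 ≤ t) (z : Fin nY → ℝ) :
    ∑ j, (2 * (∑ k, l k * (Y j k k).re) * z j - z j ^ 2 *
      ((∑ i, s i * ((X i * Y j).trace).re) + t * (∑ k, l k * (Y j k k).re)))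
    ≤ ∑ k, ∑ i, (X i k k).re * (l k ^ 2 / (s i + t * l k)) := by
  set Z : Matrix (Fin d) (Fin d) ℂ := ∑ j, (z j : ℂ) • Y j with hZ
  have hZh : Zᴴ = Z := by
    rw [hZ, conjTranspose_sum]
    refine Finset.sum_congr rfl fun j _ => ?_
    rw [conjTranspose_smul, (hYherm j).eq]; simp
  have hZ2 : Z * Z = ∑ j, ((z j ^ 2 : ℝ) : ℂ) • Y j := by
    rw [hZ, Finset.sum_mul]
    refine Finset.sum_congr rfl fun j _ => ?_
    rw [Finset.mul_sum, Finset.sum_eq_single j]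
    · rw [smul_mul_smul_comm, hYproj]; push_cast; rw [sq]
    · intro k _ hk
      rw [smul_mul_smul_comm, hYorth j k hk.symm, smul_zero]
    · simp
  have key : ∀ k i, 2 * l k * ((X i * Z) k k).re - (s i + t * l k) * ((Z * X i * Z) k k).re
      ≤ (X i k k).re * (l k ^ 2 / (s i + t * l k)) := by
    intro k i
    have hc : 0 < s i + t * l k := by
      have := mul_nonneg ht (hl k); have := hs i; linarith
    set c := s i + t * l k
    have h1 := (posSemidef_conjTranspose_mul_self
      ((l k : ℂ) • X i - (c : ℂ) • (X i * Z))).diag_nonneg (i := k)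
    have h2 : ((l k : ℂ) • X i - (c : ℂ) • (X i * Z))ᴴ * ((l k : ℂ) • X i - (c : ℂ) • (X i * Z))
      = ((l k ^ 2 : ℝ) : ℂ) • X i - ((l k * c : ℝ) : ℂ) • (X i * Z + Z * X i)
        + ((c ^ 2 : ℝ) : ℂ) • (Z * X i * Z) := by
      have e1 : X i * (X i * Z) = X i * Z := by rw [← mul_assoc, hXproj]
      have e2 : Z * X i * X i = Z * X i := by rw [mul_assoc, hXproj]
      have e3 : Z * X i * (X i * Z) = Z * X i * Z := by rw [← mul_assoc, e2]
      rw [conjTranspose_sub, conjTranspose_smul, conjTranspose_smul, conjTranspose_mul, hZh,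
        (hXherm i).eq, sub_mul, mul_sub, mul_sub]
      simp only [smul_mul_smul_comm, hXproj, e1, e2, e3]
      simp only [RCLike.star_def, Complex.conj_ofReal]
      push_cast
      module
    rw [h2] at h1
    have h3 := (Complex.le_def.1 h1).1
    have h4 : ((Z * X i) k k).re = ((X i * Z) k k).re := by
      have : (X i * Z)ᴴ = Z * X i := by rw [conjTranspose_mul, hZh, (hXherm i).eq]
      rw [← this, conjTranspose_apply]; simp
    simp only [Matrix.add_apply, Matrix.sub_apply, Matrix.smul_apply, smul_eq_mul, Complex.add_re, Complex.sub_re,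
      Complex.re_ofReal_mul, h4, Complex.zero_re] at h3
    rw [← mul_div_assoc, le_div_iff₀ hc]
    nlinarith
  refine le_trans (le_of_eq ?_) (Finset.sum_le_sum fun k _ => Finset.sum_le_sum fun i _ => key k i)
  have a1 : ∀ k, ∑ i, ((X i * Z) k k).re = ∑ j, z j * (Y j k k).re := by
    intro k
    have : ∑ i, X i * Z = Z := by rw [← Finset.sum_mul, hXsum, one_mul]
    rw [← Complex.re_sum, ← Matrix.sum_apply, this, hZ, Matrix.sum_apply, Complex.re_sum]
    simp
  have a2 : ∀ k, ∑ i, ((Z * X i * Z) k k).re = ∑ j, z j ^ 2 * (Y j k k).re := by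
    intro k
    have : ∑ i, Z * X i * Z = Z * Z := by rw [← Finset.sum_mul, ← Finset.mul_sum, hXsum, mul_one]
    rw [← Complex.re_sum, ← Matrix.sum_apply, this, hZ2, Matrix.sum_apply, Complex.re_sum]
    simp only [Matrix.smul_apply, smul_eq_mul, Complex.re_ofReal_mul]
  have a3 : ∀ i, ∑ k, ((Z * X i * Z) k k).re = ∑ j, z j ^ 2 * ((X i * Y j).trace).re := by
    intro i
    have : (Z * X i * Z).trace = ∑ j, ((z j ^ 2 : ℝ) : ℂ) * (X i * Y j).trace := by
      rw [mul_assoc, trace_mul_comm, mul_assoc, hZ2, Finset.mul_sum, trace_sum]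
      simp only [mul_smul_comm, trace_smul, smul_eq_mul]
    rw [← Complex.re_sum]
    change ((Z * X i * Z).trace).re = _
    rw [this, Complex.re_sum]
    simp only [Complex.re_ofReal_mul]
  have b : ∑ k, ∑ i, (2 * l k * ((X i * Z) k k).re - (s i + t * l k) * ((Z * X i * Z) k k).re)
     = ∑ k, 2 * l k * (∑ i, ((X i * Z) k k).re) - (∑ i, s i * ∑ k, ((Z * X i * Z) k k).re)
       - ∑ k, t * l k * ∑ i, ((Z * X i * Z) k k).re := by
    simp only [Finset.mul_sum, Finset.sum_sub_distrib, add_mul, Finset.sum_add_distrib]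
    rw [Finset.sum_comm (f := fun k i => s i * ((Z * X i * Z) k k).re)]
    ring
  rw [b]
  simp only [a1, a2, a3]
  have c1 : ∑ k, 2 * l k * ∑ j, z j * (Y j k k).re
      = ∑ j, 2 * (∑ k, l k * (Y j k k).re) * z j := by
    simp only [Finset.mul_sum, Finset.sum_mul]
    rw [Finset.sum_comm]
    exact Finset.sum_congr rfl fun _ _ => Finset.sum_congr rfl fun _ _ => by ring
  have c2 : ∑ i, s i * ∑ j, z j ^ 2 * ((X i * Y j).trace).re
      = ∑ j, z j ^ 2 * ∑ i, s i * ((X i * Y j).trace).re := by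
    simp only [Finset.mul_sum]
    rw [Finset.sum_comm]
    exact Finset.sum_congr rfl fun _ _ => Finset.sum_congr rfl fun _ _ => by ring
  have c3 : ∑ k, t * l k * ∑ j, z j ^ 2 * (Y j k k).re
      = ∑ j, z j ^ 2 * (t * ∑ k, l k * (Y j k k).re) := by
    simp only [Finset.mul_sum]
    rw [Finset.sum_comm]
    exact Finset.sum_congr rfl fun _ _ => Finset.sum_congr rfl fun _ _ => by ring
  rw [c1, c2, c3, ← Finset.sum_sub_distrib, ← Finset.sum_sub_distrib]
  exact Finset.sum_congr rfl fun _ _ => by ring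


/-- scalar integration step -/
theorem eu_int {K J : Type*} [Fintype K] [Fintype J]
    (x l s : K → ℝ) (q r : J → ℝ) (hl : ∀ k, 0 ≤ l k) (hs : ∀ k, 0 < s k)
    (hq : ∀ j, 0 ≤ q j) (hr : ∀ j, 0 ≤ r j) (hqr : ∀ j, r j = 0 → q j = 0)
    (hquad : ∀ t : ℝ, 0 ≤ t → ∑ j, q j ^ 2 / (r j + t * q j) ≤
      ∑ k, x k * (l k ^ 2 / (s k + t * l k))) (T : ℝ) (hT : 0 ≤ T) :
    ∑ j, q j * (Real.log (r j + T * q j) - Real.log (r j)) ≤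
      ∑ k, x k * (l k * (Real.log (s k + T * l k) - Real.log (s k))) := by
  have hder : ∀ a b t : ℝ, 0 ≤ a → 0 ≤ b → (b = 0 → a = 0) → 0 ≤ t →
      HasDerivAt (fun t => a * (Real.log (b + t * a) - Real.log b)) (a ^ 2 / (b + t * a)) t := by
    intro a b t ha hb hab ht
    rcases hb.eq_or_lt with h | h
    · have := hab h.symm
      subst this
      simpa using hasDerivAt_const t (0:ℝ)
    · have hp : 0 < b + t * a := by positivity
      have h1 : HasDerivAt (fun t => b + t * a) a t := by
        simpa using ((hasDerivAt_id t).mul_const a).const_add b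
      have := ((h1.log hp.ne').sub_const (Real.log b)).const_mul a
      have e : a ^ 2 / (b + t * a) = a * (a / (b + t * a)) := by ring
      rw [e]
      exact this
  let g : ℝ → ℝ := fun t => ∑ k, x k * (l k * (Real.log (s k + t * l k) - Real.log (s k))) -
    ∑ j, q j * (Real.log (r j + t * q j) - Real.log (r j))
  have hg : ∀ t, 0 ≤ t → HasDerivAt g (∑ k, x k * (l k ^ 2 / (s k + t * l k)) -
      ∑ j, q j ^ 2 / (r j + t * q j)) t := by
    intro t ht
    refine HasDerivAt.sub (HasDerivAt.fun_sum fun k _ => ?_) (HasDerivAt.fun_sum fun j _ => ?_)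
    · exact (hder _ _ t (hl k) (hs k).le (fun h => absurd h (hs k).ne') ht).const_mul _
    · exact hder _ _ t (hq j) (hr j) (hqr j) ht
  have hm : MonotoneOn g (Set.Ici 0) := by
    refine monotoneOn_of_deriv_nonneg (convex_Ici 0)
      (fun t ht => (hg t ht).continuousAt.continuousWithinAt)
      (fun t ht => ?_) (fun t ht => ?_)
    · rw [interior_Ici] at ht
      exact (hg t (le_of_lt ht)).differentiableAt.differentiableWithinAt
    · rw [interior_Ici] at ht
      rw [(hg t (le_of_lt ht)).deriv]
      have := hquad t (le_of_lt ht)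
      linarith
  have h0 : g 0 = 0 := by simp [g]
  have := hm (Set.mem_Ici.2 le_rfl) (Set.mem_Ici.2 hT) hT
  rw [h0] at this
  simp only [g] at this
  linarith

theorem eu_lim {K J : Type*} [Fintype K] [Fintype J]
    (x l s : K → ℝ) (q r : J → ℝ) (hl : ∀ k, 0 ≤ l k) (hs : ∀ k, 0 < s k)
    (hq : ∀ j, 0 ≤ q j) (hr : ∀ j, 0 ≤ r j) (hqr : ∀ j, r j = 0 → q j = 0)
    (hquad : ∀ t : ℝ, 0 ≤ t → ∑ j, q j ^ 2 / (r j + t * q j) ≤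
      ∑ k, x k * (l k ^ 2 / (s k + t * l k)))
    (hsum : ∑ k, x k * l k = ∑ j, q j) :
    ∑ j, q j * (Real.log (q j) - Real.log (r j)) ≤
      ∑ k, x k * (l k * (Real.log (l k) - Real.log (s k))) := by
  have hcont : ∀ a b : ℝ, 0 ≤ a → Filter.Tendsto
      (fun τ : ℝ => a * (Real.log (a + τ * b) - Real.log b)) (nhdsWithin 0 (Set.Ioi 0))
      (nhds (a * (Real.log a - Real.log b))) := by
    intro a b ha
    rcases ha.eq_or_lt with h | h
    · subst h; simp
    · refine Filter.Tendsto.mono_left ?_ nhdsWithin_le_nhds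
      have : ContinuousAt (fun τ : ℝ => a * (Real.log (a + τ * b) - Real.log b)) 0 := by
        have h1 : ContinuousAt (fun τ : ℝ => a + τ * b) 0 := by fun_prop
        exact ((h1.log (by simpa using h.ne')).sub continuousAt_const).const_mul _
      simpa [ContinuousAt] using this
  refine le_of_tendsto_of_tendsto (b := nhdsWithin (0:ℝ) (Set.Ioi 0))
    (tendsto_finsetSum _ fun j _ => hcont (q j) (r j) (hq j))
    (tendsto_finsetSum _ fun k _ => (hcont (l k) (s k) (hl k)).const_mul (x k)) ?_
  filter_upwards [self_mem_nhdsWithin] with τ hτ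
  have hτ : 0 < τ := hτ
  have h := eu_int x l s q r hl hs hq hr hqr hquad τ⁻¹ (by positivity)
  have e : ∀ a b : ℝ, 0 ≤ a → 0 ≤ b → (b = 0 → a = 0) →
      a * (Real.log (a + τ * b) - Real.log b) =
      a * (Real.log (b + τ⁻¹ * a) - Real.log b) + a * Real.log τ := by
    intro a b ha hb hab
    rcases hb.eq_or_lt with h | h
    · rw [hab h.symm]; simp
    · have : a + τ * b = τ * (b + τ⁻¹ * a) := by field_simp; ring
      rw [this, Real.log_mul hτ.ne' (by positivity)]
      ring
  have e1 : ∑ j, q j * (Real.log (q j + τ * r j) - Real.log (r j)) =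
    ∑ j, q j * (Real.log (r j + τ⁻¹ * q j) - Real.log (r j)) + (∑ j, q j) * Real.log τ := by
    rw [Finset.sum_mul, ← Finset.sum_add_distrib]
    exact Finset.sum_congr rfl fun j _ => e _ _ (hq j) (hr j) (hqr j)
  have e2 : ∑ k, x k * (l k * (Real.log (l k + τ * s k) - Real.log (s k))) =
    ∑ k, x k * (l k * (Real.log (s k + τ⁻¹ * l k) - Real.log (s k)))
      + (∑ k, x k * l k) * Real.log τ := by
    rw [Finset.sum_mul, ← Finset.sum_add_distrib]
    refine Finset.sum_congr rfl fun k _ => ?_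
    rw [e _ _ (hl k) (hs k).le (fun h => absurd h (hs k).ne')]
    ring
  rw [e1, e2, hsum]
  linarith

/-- Gibbs -/
theorem eu_gibbs {J : Type*} [Fintype J] (q r y : J → ℝ)
    (hq : ∀ j, 0 ≤ q j) (hr : ∀ j, 0 ≤ r j) (hqr : ∀ j, r j = 0 → q j = 0)
    (hq1 : ∑ j, q j = 1) (hy : ∀ j, 0 < y j) :
    Real.exp (∑ j, q j * (Real.log (r j) - Real.log (q j) + Real.log (y j))) ≤
      ∑ j, r j * y j := by
  have := convexOn_exp.map_sum_le (t := Finset.univ) (w := q)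
    (p := fun j => Real.log (r j) - Real.log (q j) + Real.log (y j))
    (fun j _ => hq j) hq1 (fun _ _ => Set.mem_univ _)
  simp only [smul_eq_mul] at this
  refine this.trans (Finset.sum_le_sum fun j _ => ?_)
  rcases (hq j).eq_or_lt with h | h
  · rw [← h]; have := mul_nonneg (hr j) (hy j).le; simpa
  · have hr' : 0 < r j := lt_of_le_of_ne (hr j) fun h' => h.ne' (hqr j h'.symm)
    rw [Real.exp_add, Real.exp_sub, Real.exp_log h, Real.exp_log hr', Real.exp_log (hy j)]
    apply le_of_eq; field_simp

theorem eu_bdd {m n : Type*} [Fintype m] [Fintype n] (r s : ℝ) (hr : 0 < r) (hs : 0 < s)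
    (C : Matrix m n ℂ) :
    BddAbove {t : ℝ | ∃ φ : n → ℂ, φ ≠ 0 ∧ t = vecPNorm s (C.mulVec φ) / vecPNorm r φ} := by
  refine ⟨(∑ i, (∑ j, ‖C i j‖) ^ s) ^ (1 / s), ?_⟩
  rintro t ⟨φ, hφ, rfl⟩
  have hnn : ∀ j, 0 ≤ ‖φ j‖ ^ r := fun j => Real.rpow_nonneg (norm_nonneg _) _
  have hN : ∀ j, ‖φ j‖ ≤ vecPNorm r φ := by
    intro j
    have h1 : ‖φ j‖ ^ r ≤ ∑ i, ‖φ i‖ ^ r :=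
      Finset.single_le_sum (fun i _ => hnn i) (Finset.mem_univ j)
    have h2 := Real.rpow_le_rpow (hnn j) h1 (z := 1 / r) (by positivity)
    rwa [← Real.rpow_mul (norm_nonneg _), mul_one_div_cancel hr.ne', Real.rpow_one] at h2
  have hpos : 0 < vecPNorm r φ := by
    obtain ⟨j, hj⟩ := Function.ne_iff.1 hφ
    exact lt_of_lt_of_le (norm_pos_iff.2 hj) (hN j)
  rw [div_le_iff₀ hpos]
  set N := vecPNorm r φ
  have h3 : ∀ i, ‖C.mulVec φ i‖ ≤ (∑ j, ‖C i j‖) * N := by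
    intro i
    rw [Finset.sum_mul]
    refine (norm_sum_le _ _).trans (Finset.sum_le_sum fun j _ => ?_)
    rw [norm_mul]
    exact mul_le_mul_of_nonneg_left (hN j) (norm_nonneg _)
  have hD : ∀ i, 0 ≤ ∑ j, ‖C i j‖ := fun i => Finset.sum_nonneg fun j _ => norm_nonneg _
  have hS : 0 ≤ ∑ i, (∑ j, ‖C i j‖) ^ s :=
    Finset.sum_nonneg fun i _ => Real.rpow_nonneg (hD i) _
  calc vecPNorm s (C.mulVec φ) ≤ (∑ i, ((∑ j, ‖C i j‖) * N) ^ s) ^ (1 / s) := by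
        refine Real.rpow_le_rpow (Finset.sum_nonneg fun i _ => Real.rpow_nonneg (norm_nonneg _) _)
          (Finset.sum_le_sum fun i _ => ?_) (by positivity)
        exact Real.rpow_le_rpow (norm_nonneg _) (h3 i) hs.le
    _ = (∑ i, (∑ j, ‖C i j‖) ^ s) ^ (1 / s) * N := by
        simp only [Real.mul_rpow (hD _) hpos.le]
        rw [← Finset.sum_mul, Real.mul_rpow hS (Real.rpow_nonneg hpos.le _),
          ← Real.rpow_mul hpos.le, mul_one_div_cancel hs.ne', Real.rpow_one]

theorem eu_holder {m n : Type*} [Fintype m] [Fintype n] (C : Matrix m n ℝ)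
    (hC : ∀ i j, 0 ≤ C i j) (θ η : ℝ) (hθ0 : 0 ≤ θ) (hθ1 : θ < 1) (hη : 0 < η)
    (p : m → ℝ) (q : n → ℝ) (hp : ∀ i, 0 ≤ p i) (hq : ∀ j, 0 ≤ q j)
    (hp1 : ∑ i, p i = 1) (hq1 : ∑ j, q j = 1) :
    ∑ i, ∑ j, (if 0 < p i then p i ^ θ else 0) * (if 0 < q j then q j ^ η else 0) * C i j
      ≤ matPNorm (1 / η) (1 / (1 - θ)) (C.map Complex.ofReal) := by
  set u : m → ℝ := fun i => if 0 < p i then p i ^ θ else 0 with hu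
  set v : n → ℝ := fun j => if 0 < q j then q j ^ η else 0 with hv
  have hu0 : ∀ i, 0 ≤ u i := by
    intro i; simp only [hu]; split_ifs
    · exact Real.rpow_nonneg (hp i) _
    · exact le_rfl
  have hv0 : ∀ j, 0 ≤ v j := by
    intro j; simp only [hv]; split_ifs
    · exact Real.rpow_nonneg (hq j) _
    · exact le_rfl
  have hvq : ∀ j, v j ^ (1 / η) = q j := by
    intro j; simp only [hv]; split_ifs with h
    · rw [← Real.rpow_mul (hq j), mul_one_div_cancel hη.ne', Real.rpow_one]
    · rw [Real.zero_rpow (by positivity)]; linarith [hq j]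
  let φ : n → ℂ := fun j => (v j : ℂ)
  have hφn : vecPNorm (1 / η) φ = 1 := by
    simp only [vecPNorm, φ, Complex.norm_real, Real.norm_eq_abs, abs_of_nonneg (hv0 _), hvq, hq1,
      Real.one_rpow]
  have hφ : φ ≠ 0 := by
    intro h
    have : ∀ j, q j = 0 := by
      intro j
      have hj : v j = 0 := by simpa [φ] using congrFun h j
      rw [← hvq j, hj, Real.zero_rpow (by positivity)]
    simp [this] at hq1
  have h1θ : 0 < 1 - θ := by linarith
  have hle : vecPNorm (1 / (1 - θ)) ((C.map Complex.ofReal).mulVec φ) ≤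
      matPNorm (1 / η) (1 / (1 - θ)) (C.map Complex.ofReal) := by
    refine le_csSup (eu_bdd _ _ (by positivity) (by positivity) _) ⟨φ, hφ, ?_⟩
    rw [hφn, div_one]
  refine le_trans ?_ hle
  set w : m → ℝ := fun i => ∑ j, C i j * v j with hw
  have hw0 : ∀ i, 0 ≤ w i := fun i => Finset.sum_nonneg fun j _ => mul_nonneg (hC i j) (hv0 j)
  have hCw : ∀ i, ‖(C.map Complex.ofReal).mulVec φ i‖ = w i := by
    intro i
    have : (C.map Complex.ofReal).mulVec φ i = (w i : ℂ) := by
      simp [Matrix.mulVec, dotProduct, φ, hw]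
    rw [this, Complex.norm_real, Real.norm_eq_abs, abs_of_nonneg (hw0 i)]
  have hL : ∑ i, ∑ j, u i * v j * C i j = ∑ i, u i * w i := by
    refine Finset.sum_congr rfl fun i _ => ?_
    rw [hw, Finset.mul_sum]
    exact Finset.sum_congr rfl fun j _ => by ring
  rw [hL]
  simp only [vecPNorm, hCw]
  rcases hθ0.eq_or_lt with h | h
  · have : ∀ i, u i ≤ 1 := by
      intro i; simp only [hu, ← h]; split_ifs <;> simp
    rw [← h]; simp only [sub_zero, div_one, Real.rpow_one]
    exact Finset.sum_le_sum fun i _ => mul_le_of_le_one_left (hw0 i) (this i)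
  · have huq : ∀ i, u i ^ (1 / θ) = p i := by
      intro j; simp only [hu]; split_ifs with h'
      · rw [← Real.rpow_mul (hp j), mul_one_div_cancel h.ne', Real.rpow_one]
      · rw [Real.zero_rpow (by positivity)]; linarith [hp j]
    have hconj : (1 / θ).HolderConjugate (1 / (1 - θ)) := by
      rw [Real.holderConjugate_iff]
      refine ⟨by rw [lt_div_iff₀ h]; linarith, by simp⟩
    have := Real.inner_le_Lp_mul_Lq_of_nonneg (Finset.univ) hconj
      (f := u) (g := w) (fun i _ => hu0 i) (fun i _ => hw0 i)
    simpa only [huq, hp1, Real.one_rpow, one_mul] using this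

open Matrix in
theorem eu_diag {d nX nY : ℕ}
    (X : Fin nX → Matrix (Fin d) (Fin d) ℂ) (Y : Fin nY → Matrix (Fin d) (Fin d) ℂ)
    (hXherm : ∀ i, (X i).IsHermitian) (hXproj : ∀ i, X i * X i = X i)
    (hXsum : ∑ i, X i = 1)
    (hYherm : ∀ j, (Y j).IsHermitian) (hYproj : ∀ j, Y j * Y j = Y j)
    (hYorth : ∀ j k, j ≠ k → Y j * Y k = 0) (hYsum : ∑ j, Y j = 1)
    (l : Fin d → ℝ) (hl : ∀ k, 0 ≤ l k) (hl1 : ∑ k, l k = 1)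
    (s : Fin nX → ℝ) (hs : ∀ i, 0 < s i) (y : Fin nY → ℝ) (hy : ∀ j, 0 < y j) :
    Real.exp (-∑ k, l k * Real.log (l k) + ∑ i, (∑ k, l k * (X i k k).re) * Real.log (s i)
      + ∑ j, (∑ k, l k * (Y j k k).re) * Real.log (y j))
    ≤ ∑ i, ∑ j, s i * y j * ((X i * Y j).trace).re := by
  have hYd : ∀ j k, 0 ≤ (Y j k k).re := by
    intro j k
    have h := (posSemidef_conjTranspose_mul_self (Y j)).diag_nonneg (i := k)
    rw [(hYherm j).eq, hYproj] at h
    exact (Complex.le_def.1 h).1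
  have hC : ∀ i j, 0 ≤ ((X i * Y j).trace).re := by
    intro i j
    have h := (posSemidef_conjTranspose_mul_self (X i * Y j)).trace_nonneg
    have e : ((X i * Y j)ᴴ * (X i * Y j)).trace = (X i * Y j).trace := by
      rw [conjTranspose_mul, (hYherm j).eq, (hXherm i).eq, mul_assoc, ← mul_assoc (X i), hXproj,
        trace_mul_comm, mul_assoc, hYproj]
    rw [e] at h
    exact (Complex.le_def.1 h).1
  have hXs : ∀ k, ∑ i, (X i k k).re = 1 := by
    intro k
    rw [← Complex.re_sum, ← Matrix.sum_apply, hXsum]; simp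
  have hYs : ∀ k, ∑ j, (Y j k k).re = 1 := by
    intro k
    rw [← Complex.re_sum, ← Matrix.sum_apply, hYsum]; simp
  set q : Fin nY → ℝ := fun j => ∑ k, l k * (Y j k k).re with hqdef
  set r : Fin nY → ℝ := fun j => ∑ i, s i * ((X i * Y j).trace).re with hrdef
  have hq : ∀ j, 0 ≤ q j := fun j => Finset.sum_nonneg fun k _ => mul_nonneg (hl k) (hYd j k)
  have hr : ∀ j, 0 ≤ r j := fun j => Finset.sum_nonneg fun i _ => mul_nonneg (hs i).le (hC i j)
  have hq1 : ∑ j, q j = 1 := by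
    rw [hqdef, Finset.sum_comm]
    simp only [← Finset.mul_sum, hYs, mul_one, hl1]
  have hqr : ∀ j, r j = 0 → q j = 0 := by
    intro j hj
    have h1 := (Finset.sum_eq_zero_iff_of_nonneg
      (fun i _ => mul_nonneg (hs i).le (hC i j))).1 hj
    have h2 : ∑ k, (Y j k k).re = 0 := by
      have e : (Y j).trace = ∑ i, (X i * Y j).trace := by
        rw [← trace_sum, ← Finset.sum_mul, hXsum, one_mul]
      rw [← Complex.re_sum]
      change ((Y j).trace).re = 0
      rw [e, Complex.re_sum]
      refine Finset.sum_eq_zero fun i hi => ?_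
      exact (mul_eq_zero.1 (h1 i hi)).resolve_left (hs i).ne'
    have h3 := (Finset.sum_eq_zero_iff_of_nonneg (fun k _ => hYd j k)).1 h2
    exact Finset.sum_eq_zero fun k hk => by rw [h3 k hk, mul_zero]
  have hquad : ∀ t : ℝ, 0 ≤ t → ∑ j, q j ^ 2 / (r j + t * q j) ≤
      ∑ a : Fin d × Fin nX, (X a.2 a.1 a.1).re * (l a.1 ^ 2 / (s a.2 + t * l a.1)) := by
    intro t ht
    have h := eu_quad X Y hXherm hXproj hXsum hYherm hYproj hYorth l hl s hs t ht
      (fun j => q j / (r j + t * q j))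
    rw [Fintype.sum_prod_type]
    refine le_trans (le_of_eq (Finset.sum_congr rfl fun j _ => ?_)) h
    change _ = 2 * q j * (q j / (r j + t * q j)) - (q j / (r j + t * q j)) ^ 2 * (r j + t * q j)
    rcases (hq j).eq_or_lt with h0 | h0
    · rw [← h0]; simp
    · have hr' : 0 < r j := lt_of_le_of_ne (hr j) fun h' => h0.ne' (hqr j h'.symm)
      have : 0 < r j + t * q j := by positivity
      field_simp
      ring
  have hsum : ∑ a : Fin d × Fin nX, (X a.2 a.1 a.1).re * l a.1 = ∑ j, q j := by
    rw [hq1, Fintype.sum_prod_type]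
    simp only [← Finset.sum_mul, hXs, one_mul, hl1]
  have hlim := eu_lim (fun a : Fin d × Fin nX => (X a.2 a.1 a.1).re) (fun a => l a.1)
    (fun a => s a.2) q r (fun a => hl a.1) (fun a => hs a.2) hq hr hqr hquad hsum
  have hG := eu_gibbs q r y hq hr hqr hq1 hy
  have hR : ∑ i, ∑ j, s i * y j * ((X i * Y j).trace).re = ∑ j, r j * y j := by
    rw [Finset.sum_comm]
    refine Finset.sum_congr rfl fun j _ => ?_
    rw [hrdef, Finset.sum_mul]
    exact Finset.sum_congr rfl fun i _ => by ring
  rw [hR]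
  refine le_trans (Real.exp_le_exp.2 ?_) hG
  have hE : ∑ a : Fin d × Fin nX, (X a.2 a.1 a.1).re * (l a.1 * (Real.log (l a.1) - Real.log (s a.2)))
      = ∑ k, l k * Real.log (l k) - ∑ i, (∑ k, l k * (X i k k).re) * Real.log (s i) := by
    rw [Fintype.sum_prod_type]
    have e1 : ∑ k, l k * Real.log (l k) = ∑ k, ∑ i, (X i k k).re * (l k * Real.log (l k)) := by
      simp only [← Finset.sum_mul, hXs, one_mul]
    have e2 : ∑ i, (∑ k, l k * (X i k k).re) * Real.log (s i)
        = ∑ k, ∑ i, (X i k k).re * (l k * Real.log (s i)) := by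
      simp only [Finset.sum_mul]
      rw [Finset.sum_comm]
      exact Finset.sum_congr rfl fun _ _ => Finset.sum_congr rfl fun _ _ => by ring
    rw [e1, e2]
    simp only [← Finset.sum_sub_distrib]
    exact Finset.sum_congr rfl fun _ _ => Finset.sum_congr rfl fun _ _ => by ring
  rw [hE] at hlim
  have hF : ∑ j, q j * (Real.log (r j) - Real.log (q j) + Real.log (y j)) =
      ∑ j, q j * Real.log (y j) - ∑ j, q j * (Real.log (q j) - Real.log (r j)) := by
    rw [← Finset.sum_sub_distrib]
    exact Finset.sum_congr rfl fun _ _ => by ring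
  rw [hF]
  linarith

open Matrix in
theorem eu_gen {d nX nY : ℕ}
    (X : Fin nX → Matrix (Fin d) (Fin d) ℂ) (Y : Fin nY → Matrix (Fin d) (Fin d) ℂ)
    (hXherm : ∀ i, (X i).IsHermitian) (hXproj : ∀ i, X i * X i = X i)
    (hXsum : ∑ i, X i = 1)
    (hYherm : ∀ j, (Y j).IsHermitian) (hYproj : ∀ j, Y j * Y j = Y j)
    (hYorth : ∀ j k, j ≠ k → Y j * Y k = 0) (hYsum : ∑ j, Y j = 1)
    (ρ : Matrix (Fin d) (Fin d) ℂ) (hρ : ρ.PosSemidef) (hρtr : ρ.trace = 1)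
    (s : Fin nX → ℝ) (hs : ∀ i, 0 < s i) (y : Fin nY → ℝ) (hy : ∀ j, 0 < y j) :
    Real.exp (vonNeumannEntropy ρ + ∑ i, ((ρ * X i).trace).re * Real.log (s i)
      + ∑ j, ((ρ * Y j).trace).re * Real.log (y j))
    ≤ ∑ i, ∑ j, s i * y j * ((X i * Y j).trace).re := by
  have h : ρ.IsHermitian := hρ.1
  set U : Matrix (Fin d) (Fin d) ℂ := (h.eigenvectorUnitary : Matrix (Fin d) (Fin d) ℂ) with hU
  have hUU : Uᴴ * U = 1 := by
    rw [hU, ← star_eq_conjTranspose]; exact Unitary.coe_star_mul_self _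
  have hUU' : U * Uᴴ = 1 := by
    rw [hU, ← star_eq_conjTranspose]; exact Unitary.coe_mul_star_self _
  have hspec : ρ = U * diagonal (fun k => (h.eigenvalues k : ℂ)) * Uᴴ := by
    have := h.spectral_theorem
    rw [Unitary.conjStarAlgAut_apply] at this
    exact this
  have hmul : ∀ A B : Matrix (Fin d) (Fin d) ℂ, (Uᴴ * A * U) * (Uᴴ * B * U) = Uᴴ * (A * B) * U := by
    intro A B
    calc (Uᴴ * A * U) * (Uᴴ * B * U) = Uᴴ * A * (U * Uᴴ) * B * U := by simp only [mul_assoc]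
      _ = _ := by rw [hUU']; simp only [mul_assoc, one_mul]
  have htr : ∀ A : Matrix (Fin d) (Fin d) ℂ, (Uᴴ * A * U).trace = A.trace := by
    intro A
    rw [trace_mul_comm, ← mul_assoc, hUU', one_mul]
  have hherm : ∀ A : Matrix (Fin d) (Fin d) ℂ, A.IsHermitian → (Uᴴ * A * U).IsHermitian :=
    fun A hA => isHermitian_conjTranspose_mul_mul U hA
  have hρt : ∀ A : Matrix (Fin d) (Fin d) ℂ, ((ρ * A).trace).re
      = ∑ k, h.eigenvalues k * ((Uᴴ * A * U) k k).re := by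
    intro A
    have : (ρ * A).trace = (diagonal (fun k => (h.eigenvalues k : ℂ)) * (Uᴴ * A * U)).trace := by
      conv_lhs => rw [hspec]
      rw [mul_assoc, mul_assoc, trace_mul_comm]
      simp only [mul_assoc]
    rw [this, trace, Complex.re_sum]
    refine Finset.sum_congr rfl fun k _ => ?_
    rw [diag_apply, diagonal_mul, Complex.re_ofReal_mul]
  have hsumc : ∀ {n : ℕ} (A : Fin n → Matrix (Fin d) (Fin d) ℂ), ∑ i, A i = 1 →
      ∑ i, Uᴴ * A i * U = 1 := by
    intro n A hA
    rw [← Finset.sum_mul, ← Finset.mul_sum, hA, mul_one, hUU]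
  have hl1 : ∑ k, h.eigenvalues k = 1 := by
    have := hρt 1
    rw [mul_one, hρtr, mul_one, hUU] at this
    simpa using this.symm
  have main := eu_diag (fun i => Uᴴ * X i * U) (fun j => Uᴴ * Y j * U)
    (fun i => hherm _ (hXherm i)) (fun i => by rw [hmul, hXproj]) (hsumc X hXsum)
    (fun j => hherm _ (hYherm j)) (fun j => by rw [hmul, hYproj])
    (fun j k hjk => by rw [hmul, hYorth j k hjk, mul_zero, zero_mul]) (hsumc Y hYsum)
    h.eigenvalues hρ.eigenvalues_nonneg hl1 s hs y hy
  simp only [hmul, htr, ← hρt] at main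
  rw [vonNeumannEntropy, dif_pos h]
  exact main

/-- **Main theorem (entropic uncertainty relation for mixed states).**
For projective measurements `X`, `Y` on `ℂ^d` with overlap matrix
`C⁽²⁾_{ij} = tr(X_i Y_j)`, parameters `0 < μ ≤ α ≤ 1`, `0 ≤ λ < α`, and any density
matrix `ρ`:
`λ H(X) + μ H(Y) ≥ α S(ρ) - α log ‖C⁽²⁾‖_{(α/μ) → (α/(α-λ))}`. -/
theorem entropic_uncertainty_mixed_states {d nX nY : ℕ}
    (X : Fin nX → Matrix (Fin d) (Fin d) ℂ) (Y : Fin nY → Matrix (Fin d) (Fin d) ℂ)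
    (hXherm : ∀ i, (X i).IsHermitian) (hXproj : ∀ i, X i * X i = X i)
    (hXorth : ∀ i j, i ≠ j → X i * X j = 0) (hXsum : ∑ i, X i = 1)
    (hYherm : ∀ j, (Y j).IsHermitian) (hYproj : ∀ j, Y j * Y j = Y j)
    (hYorth : ∀ j k, j ≠ k → Y j * Y k = 0) (hYsum : ∑ j, Y j = 1)
    (C2 : Matrix (Fin nX) (Fin nY) ℝ)
    (hC2 : ∀ i j, (C2 i j : ℂ) = (X i * Y j).trace)
    (α lam μ : ℝ) (hμ0 : 0 < μ) (hμα : μ ≤ α) (hα1 : α ≤ 1)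
    (hlam0 : 0 ≤ lam) (hlamα : lam < α)
    (ρ : Matrix (Fin d) (Fin d) ℂ) (hρ : ρ.PosSemidef) (hρtr : ρ.trace = 1) :
    lam * shannonEntropy (fun i => ((ρ * X i).trace).re)
      + μ * shannonEntropy (fun j => ((ρ * Y j).trace).re)
    ≥ α * vonNeumannEntropy ρ
      - α * Real.log (matPNorm (α / μ) (α / (α - lam)) (C2.map Complex.ofReal)) := by
  classical
  have h : ρ.IsHermitian := hρ.1
  have hα : 0 < α := lt_of_lt_of_le hμ0 hμα
  have hC2' : ∀ i j, C2 i j = ((X i * Y j).trace).re := by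
    intro i j; rw [← hC2]; simp
  have hpos : ∀ A : Matrix (Fin d) (Fin d) ℂ, A.IsHermitian → A * A = A →
      ∀ B : Matrix (Fin d) (Fin d) ℂ, B.PosSemidef → 0 ≤ ((B * A).trace).re := by
    intro A hA hAA B hB
    have h1 := (hB.conjTranspose_mul_mul_same A).trace_nonneg
    rw [hA.eq, Matrix.trace_mul_comm, ← mul_assoc, hAA, Matrix.trace_mul_comm] at h1
    exact (Complex.le_def.1 h1).1
  have hone : ∀ {n : ℕ} (A : Fin n → Matrix (Fin d) (Fin d) ℂ), ∑ i, A i = 1 →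
      ∑ i, ((ρ * A i).trace).re = 1 := by
    intro n A hA
    rw [← Complex.re_sum, ← Matrix.trace_sum, ← Finset.mul_sum, hA, mul_one, hρtr]; simp
  set p : Fin nX → ℝ := fun i => ((ρ * X i).trace).re with hpdef
  set q : Fin nY → ℝ := fun j => ((ρ * Y j).trace).re with hqdef
  have hp : ∀ i, 0 ≤ p i := fun i => hpos _ (hXherm i) (hXproj i) ρ hρ
  have hq : ∀ j, 0 ≤ q j := fun j => hpos _ (hYherm j) (hYproj j) ρ hρ
  have hp1 : ∑ i, p i = 1 := hone X hXsum
  have hq1 : ∑ j, q j = 1 := hone Y hYsum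
  have hC0 : ∀ i j, 0 ≤ C2 i j := by
    intro i j
    rw [hC2']
    refine hpos _ (hYherm j) (hYproj j) _ ?_
    have := Matrix.posSemidef_conjTranspose_mul_self (X i)
    rwa [(hXherm i).eq, hXproj] at this
  set θ := lam / α with hθ
  set η := μ / α with hη
  have hη0 : 0 < η := by positivity
  have hθ0 : 0 ≤ θ := by positivity
  have hθ1 : θ < 1 := by rw [hθ, div_lt_one hα]; exact hlamα
  have hH := eu_holder C2 hC0 θ η hθ0 hθ1 hη0 p q hp hq hp1 hq1
  have er : 1 / η = α / μ := by rw [hη, one_div_div]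
  have es : 1 / (1 - θ) = α / (α - lam) := by
    have : α - lam ≠ 0 := by linarith
    rw [hθ]; field_simp
  rw [er, es] at hH
  have hlog : ∀ a κ ε : ℝ, 0 ≤ a →
      a * Real.log (if 0 < a then a ^ κ else ε) = κ * (a * Real.log a) := by
    intro a κ ε ha
    split_ifs with h'
    · rw [Real.log_rpow h']; ring
    · have : a = 0 := by linarith
      simp [this]
  have hgen : ∀ ε : ℝ, 0 < ε →
      Real.exp (vonNeumannEntropy ρ - θ * shannonEntropy p - η * shannonEntropy q) ≤
      ∑ i, ∑ j, (if 0 < p i then p i ^ θ else ε) * (if 0 < q j then q j ^ η else ε) * C2 i j := by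
    intro ε hε
    have := eu_gen X Y hXherm hXproj hXsum hYherm hYproj hYorth hYsum ρ hρ hρtr
      (fun i => if 0 < p i then p i ^ θ else ε)
      (fun i => by
        split_ifs with h'
        · exact Real.rpow_pos_of_pos h' _
        · exact hε)
      (fun j => if 0 < q j then q j ^ η else ε)
      (fun i => by
        split_ifs with h'
        · exact Real.rpow_pos_of_pos h' _
        · exact hε)
    simp only [← hC2'] at this
    refine le_trans (le_of_eq ?_) this
    congr 1
    have a1 : ∑ i, ((ρ * X i).trace).re * Real.log (if 0 < p i then p i ^ θ else ε)
        = - (θ * shannonEntropy p) := by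
      rw [shannonEntropy, mul_neg, neg_neg, Finset.mul_sum]
      exact Finset.sum_congr rfl fun i _ => hlog (p i) θ ε (hp i)
    have a2 : ∑ i, ((ρ * Y i).trace).re * Real.log (if 0 < q i then q i ^ η else ε)
        = - (η * shannonEntropy q) := by
      rw [shannonEntropy, mul_neg, neg_neg, Finset.mul_sum]
      exact Finset.sum_congr rfl fun i _ => hlog (q i) η ε (hq i)
    rw [a1, a2]
    ring
  have hcont : Continuous fun ε : ℝ =>
      ∑ i, ∑ j, (if 0 < p i then p i ^ θ else ε) * (if 0 < q j then q j ^ η else ε) * C2 i j := by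
    refine continuous_finsetSum _ fun i _ => continuous_finsetSum _ fun j _ => ?_
    split_ifs <;> fun_prop
  have hexp := le_trans (ge_of_tendsto ((hcont.tendsto 0).mono_left
    (nhdsWithin_le_nhds (s := Set.Ioi 0)))
    (by filter_upwards [self_mem_nhdsWithin] with ε hε using hgen ε hε)) hH
  have hfin := (Real.le_log_iff_exp_le (lt_of_lt_of_le (Real.exp_pos _) hexp)).2 hexp
  have hmul := mul_le_mul_of_nonneg_left hfin hα.le
  have e : α * (vonNeumannEntropy ρ - θ * shannonEntropy p - η * shannonEntropy q) =
      α * vonNeumannEntropy ρ - lam * shannonEntropy p - μ * shannonEntropy q := by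
    rw [hθ, hη]; field_simp
  rw [e] at hmul
  linarith
end

section
/- (Local maximality of the uniform vector.) Let C be a d×d doubly stochastic real matrix, let μ, λ ∈ (0,1), and let σ₂ := sup{ ‖Cx‖₂ / ‖x‖₂ : x ∈ ℝ^d, x ≠ 0, ∑_i x_i = 0 } be the second largest singular value of C. If (1−μ)(1−λ) > μ λ σ₂², then the all-ones vector 𝟏 = (1, …, 1) is a local maximum, within the set of entrywise nonnegative nonzero vectors x ∈ ℝ^d, of the function f(x) = ‖Cx‖_{1/(1−λ)} / ‖x‖_{1/μ}. -/
open scoped BigOperators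

/-- The vector `p`-norm of a real vector, for a real exponent `p`. -/
noncomputable def vecPNormR {n : Type*} [Fintype n] (p : ℝ) (v : n → ℝ) : ℝ :=
  (∑ i, |v i| ^ p) ^ (1 / p)

open Filter Topology in
lemma aux_taylor (p ε : ℝ) (hε : 0 < ε) :
    ∀ᶠ y : ℝ in 𝓝 0, |(1 + y) ^ p - (1 + p * y + p * (p - 1) / 2 * y ^ 2)| ≤ ε * y ^ 2 := by
  have h := (Real.one_add_rpow_hasFPowerSeriesAt_zero (a := p)).isBigO_sub_partialSum_pow 3
  have h2 : (fun y : ℝ => ‖y‖ ^ 3) =o[𝓝 0] fun y : ℝ => y ^ 2 := by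
    have : (fun y : ℝ => y ^ 3) =o[𝓝 0] fun y : ℝ => y ^ 2 :=
      Asymptotics.isLittleO_pow_pow (by norm_num)
    simpa [norm_pow] using this.norm_left
  have h3 := (h.trans_isLittleO h2).bound hε
  filter_upwards [h3] with y hy
  have hc : Ring.choose p 2 = p * (p - 1) / 2 := by
    have := Ring.descPochhammer_eq_factorial_smul_choose p 2
    simp [descPochhammer_succ_right, Polynomial.smeval_mul, Polynomial.smeval_sub, Polynomial.smeval_X, Polynomial.smeval_one, Nat.factorial] at this
    linarith
  simp only [FormalMultilinearSeries.partialSum, Finset.sum_range_succ, binomialSeries_apply, hc] at hy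
  simpa [sq] using hy

open Filter Topology in
lemma aux_taylor_le (p k : ℝ) (hk : p * (p - 1) / 2 < k) :
    ∀ᶠ y : ℝ in 𝓝 0, (1 + y) ^ p ≤ 1 + p * y + k * y ^ 2 := by
  filter_upwards [aux_taylor p (k - p * (p - 1) / 2) (by linarith)] with y hy
  have := (abs_le.1 hy).2
  linarith

open Filter Topology in
lemma aux_taylor_ge (p k : ℝ) (hk : k < p * (p - 1) / 2) :
    ∀ᶠ y : ℝ in 𝓝 0, 1 + p * y + k * y ^ 2 ≤ (1 + y) ^ p := by
  filter_upwards [aux_taylor p (p * (p - 1) / 2 - k) (by linarith)] with y hy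
  have := (abs_le.1 hy).1
  linarith

open Filter Topology in
lemma aux_lin (q c B : ℝ) (h : q * c < B) :
    ∀ᶠ t : ℝ in 𝓝 0, 0 ≤ t → (1 + c * t) ^ q ≤ 1 + B * t := by
  set k := |q * (q - 1) / 2| + 1 with hk
  have hk0 : 0 < k := by positivity
  have h1 : Tendsto (fun t : ℝ => c * t) (𝓝 0) (𝓝 0) := by
    have : Continuous (fun t : ℝ => c * t) := by fun_prop
    simpa using this.tendsto 0
  have h2 : Tendsto (fun t : ℝ => k * c ^ 2 * t) (𝓝 0) (𝓝 0) := by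
    have : Continuous (fun t : ℝ => k * c ^ 2 * t) := by fun_prop
    simpa using this.tendsto 0
  have h3 := h1.eventually (aux_taylor_le q k (by linarith [le_abs_self (q * (q - 1) / 2)]))
  have h4 := h2.eventually (gt_mem_nhds (show (0 : ℝ) < B - q * c by linarith))
  filter_upwards [h3, h4] with t h3 h4 ht
  have := mul_le_mul_of_nonneg_right h4.le ht
  nlinarith

lemma aux_norm2 {d : ℕ} (v : Fin d → ℝ) : vecPNormR 2 v = Real.sqrt (∑ i, v i ^ 2) := by
  unfold vecPNormR
  rw [Real.sqrt_eq_rpow]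
  congr 1
  refine Finset.sum_congr rfl fun i _ => ?_
  rw [← sq_abs (v i)]
  exact_mod_cast Real.rpow_natCast (|v i|) 2

lemma aux_contr {d : ℕ} (C : Matrix (Fin d) (Fin d) ℝ)
    (hnn : ∀ i j, 0 ≤ C i j) (hrow : ∀ i, ∑ j, C i j = 1) (hcol : ∀ j, ∑ i, C i j = 1)
    (x : Fin d → ℝ) : ∑ i, (C.mulVec x i) ^ 2 ≤ ∑ i, x i ^ 2 := by
  calc ∑ i, (C.mulVec x i) ^ 2 ≤ ∑ i, ∑ j, C i j * x j ^ 2 := by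
        refine Finset.sum_le_sum fun i _ => ?_
        have := Finset.sum_sq_le_sum_mul_sum_of_sq_le_mul Finset.univ (r := fun j => C i j * x j)
          (f := fun j => C i j) (g := fun j => C i j * x j ^ 2) (fun j _ => hnn i j)
          (fun j _ => mul_nonneg (hnn i j) (sq_nonneg _)) (fun j _ => le_of_eq (by ring))
        rw [hrow, one_mul] at this
        exact this
    _ = ∑ i, x i ^ 2 := by
        rw [Finset.sum_comm]
        refine Finset.sum_congr rfl fun j _ => ?_
        rw [← Finset.sum_mul, hcol, one_mul]

lemma aux_sigma {d : ℕ} (C : Matrix (Fin d) (Fin d) ℝ)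
    (hnn : ∀ i j, 0 ≤ C i j) (hrow : ∀ i, ∑ j, C i j = 1) (hcol : ∀ j, ∑ i, C i j = 1)
    (σ₂ : ℝ)
    (hσ₂ : σ₂ = sSup {t : ℝ | ∃ x : Fin d → ℝ, x ≠ 0 ∧ (∑ i, x i = 0) ∧
        t = vecPNormR 2 (C.mulVec x) / vecPNormR 2 x})
    (x : Fin d → ℝ) (hx : ∑ i, x i = 0) :
    ∑ i, (C.mulVec x i) ^ 2 ≤ σ₂ ^ 2 * ∑ i, x i ^ 2 := by
  by_cases h0 : x = 0
  · subst h0; simp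
  have hpos : 0 < ∑ i, x i ^ 2 := by
    obtain ⟨i, hi⟩ := Function.ne_iff.1 h0
    exact Finset.sum_pos' (fun i _ => sq_nonneg _) ⟨i, Finset.mem_univ _, by have : x i ≠ 0 := hi; positivity⟩
  have hle : vecPNormR 2 (C.mulVec x) / vecPNormR 2 x ≤ σ₂ := by
    rw [hσ₂]
    refine le_csSup ⟨1, ?_⟩ ⟨x, h0, hx, rfl⟩
    rintro t ⟨y, -, -, rfl⟩
    rw [aux_norm2, aux_norm2]
    exact div_le_one_of_le₀ (Real.sqrt_le_sqrt (aux_contr C hnn hrow hcol y)) (Real.sqrt_nonneg _)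
  rw [aux_norm2, aux_norm2, div_le_iff₀ (Real.sqrt_pos.2 hpos)] at hle
  have := pow_le_pow_left₀ (Real.sqrt_nonneg _) hle 2
  rwa [mul_pow, Real.sq_sqrt hpos.le, Real.sq_sqrt (Finset.sum_nonneg fun i _ => sq_nonneg _)] at this

lemma aux_hom {d : ℕ} (p s : ℝ) (hp : 0 < p) (hs : 0 < s) (v : Fin d → ℝ) :
    vecPNormR p (fun i => s * v i) = s * vecPNormR p v := by
  unfold vecPNormR
  have : ∀ i, |s * v i| ^ p = s ^ p * |v i| ^ p := fun i => by
    rw [abs_mul, abs_of_pos hs, Real.mul_rpow hs.le (abs_nonneg _)]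
  simp only [this]
  rw [← Finset.mul_sum, Real.mul_rpow (by positivity)
    (Finset.sum_nonneg fun i _ => by positivity), ← Real.rpow_mul hs.le,
    mul_one_div_cancel hp.ne', Real.rpow_one]

lemma aux_upper {d : ℕ} (hd : 0 < d) (p A r : ℝ) (hp : 0 < p) (hr : 0 ≤ r) (y : Fin d → ℝ)
    (hy0 : ∑ i, y i = 0)
    (hy1 : ∀ i, 0 < 1 + y i) (hy : ∀ i, (1 + y i) ^ p ≤ 1 + p * y i + A * y i ^ 2)
    (hr2 : A * ∑ i, y i ^ 2 ≤ d * (p * r)) (hp1 : 1 ≤ p) :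
    vecPNormR p (fun i => 1 + y i) ≤ (d : ℝ) ^ (1 / p) * (1 + r) := by
  have hd' : (0 : ℝ) < d := by exact_mod_cast hd
  unfold vecPNormR
  have h1 : ∑ i, |1 + y i| ^ p ≤ d * (1 + r) ^ p := by
    calc ∑ i, |1 + y i| ^ p ≤ ∑ i, (1 + p * y i + A * y i ^ 2) :=
          Finset.sum_le_sum fun i _ => by rw [abs_of_pos (hy1 i)]; exact hy i
      _ = d + A * ∑ i, y i ^ 2 := by
          rw [Finset.sum_add_distrib, Finset.sum_add_distrib, ← Finset.mul_sum, ← Finset.mul_sum,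
            hy0]
          simp
      _ ≤ d * (1 + p * r) := by linarith
      _ ≤ d * (1 + r) ^ p :=
          mul_le_mul_of_nonneg_left (one_add_mul_self_le_rpow_one_add (by linarith) hp1) hd'.le
  calc _ ≤ ((d : ℝ) * (1 + r) ^ p) ^ (1 / p) :=
        Real.rpow_le_rpow (Finset.sum_nonneg fun i _ => by positivity) h1 (by positivity)
    _ = _ := by
        rw [Real.mul_rpow hd'.le (by positivity), ← Real.rpow_mul (by positivity),
          mul_one_div_cancel hp.ne', Real.rpow_one]

lemma aux_lower {d : ℕ} (hd : 0 < d) (q B r : ℝ) (hq : 0 < q) (hr : 0 ≤ r) (y : Fin d → ℝ)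
    (hy0 : ∑ i, y i = 0)
    (hy1 : ∀ i, 0 < 1 + y i) (hy : ∀ i, 1 + q * y i + B * y i ^ 2 ≤ (1 + y i) ^ q)
    (hr2 : (1 + r) ^ q ≤ 1 + B * ((∑ i, y i ^ 2) / d)) :
    (d : ℝ) ^ (1 / q) * (1 + r) ≤ vecPNormR q (fun i => 1 + y i) := by
  have hd' : (0 : ℝ) < d := by exact_mod_cast hd
  unfold vecPNormR
  have h1 : d * (1 + r) ^ q ≤ ∑ i, |1 + y i| ^ q := by
    calc d * (1 + r) ^ q ≤ d * (1 + B * ((∑ i, y i ^ 2) / d)) :=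
          mul_le_mul_of_nonneg_left hr2 hd'.le
      _ = d + B * ∑ i, y i ^ 2 := by field_simp
      _ = ∑ i, (1 + q * y i + B * y i ^ 2) := by
          rw [Finset.sum_add_distrib, Finset.sum_add_distrib, ← Finset.mul_sum, ← Finset.mul_sum,
            hy0]
          simp
      _ ≤ _ := Finset.sum_le_sum fun i _ => by rw [abs_of_pos (hy1 i)]; exact hy i
  calc _ = ((d : ℝ) * (1 + r) ^ q) ^ (1 / q) := by
        rw [Real.mul_rpow hd'.le (by positivity), ← Real.rpow_mul (by positivity),
          mul_one_div_cancel hq.ne', Real.rpow_one]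
    _ ≤ _ := Real.rpow_le_rpow (by positivity) h1 (by positivity)

lemma aux_one {d : ℕ} (p : ℝ) :
    vecPNormR p (fun _ : Fin d => (1 : ℝ)) = (d : ℝ) ^ (1 / p) := by
  simp [vecPNormR]

/-- **Local maximality of the uniform vector.** Let `C` be doubly stochastic, let
`μ, λ ∈ (0,1)`, and let `σ₂` be the second largest singular value of `C` (the supremum of
`‖Cx‖₂/‖x‖₂` over nonzero `x` with `∑ xᵢ = 0`). If `(1-μ)(1-λ) > μλσ₂²`, then the all-ones
vector is a local maximum of `x ↦ ‖Cx‖_{1/(1-λ)} / ‖x‖_{1/μ}` on the set of entrywise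
nonnegative nonzero vectors. -/
theorem one_isLocalMaxOn {d : ℕ} (C : Matrix (Fin d) (Fin d) ℝ)
    (hnn : ∀ i j, 0 ≤ C i j) (hrow : ∀ i, ∑ j, C i j = 1) (hcol : ∀ j, ∑ i, C i j = 1)
    (μ lam : ℝ) (hμ : μ ∈ Set.Ioo (0 : ℝ) 1) (hlam : lam ∈ Set.Ioo (0 : ℝ) 1)
    (σ₂ : ℝ)
    (hσ₂ : σ₂ = sSup {t : ℝ | ∃ x : Fin d → ℝ, x ≠ 0 ∧ (∑ i, x i = 0) ∧
        t = vecPNormR 2 (C.mulVec x) / vecPNormR 2 x})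
    (hcond : (1 - μ) * (1 - lam) > μ * lam * σ₂ ^ 2) :
    IsLocalMaxOn
      (fun x : Fin d → ℝ => vecPNormR (1 / (1 - lam)) (C.mulVec x) / vecPNormR (1 / μ) x)
      {x : Fin d → ℝ | (∀ i, 0 ≤ x i) ∧ x ≠ 0}
      (fun _ => 1) := by
  apply IsLocalMax.on
  obtain ⟨hμ0, hμ1⟩ := hμ
  obtain ⟨hl0, hl1⟩ := hlam
  rcases Nat.eq_zero_or_pos d with hd | hd
  · subst hd
    refine Filter.Eventually.of_forall fun x => ?_
    rw [Subsingleton.elim x (fun _ => 1)]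
  have hd' : (0 : ℝ) < d := by exact_mod_cast hd
  have hl1' : 0 < 1 - lam := by linarith
  set p := 1 / (1 - lam) with hp
  set q := 1 / μ with hq
  have hp1 : 1 ≤ p := by rw [hp, le_div_iff₀ hl1']; linarith
  have hq1 : 1 ≤ q := by rw [hq, le_div_iff₀ hμ0]; linarith
  have hp0 : 0 < p := by linarith
  have hq0 : 0 < q := by linarith
  have hpq : (p - 1) * σ₂ ^ 2 < q - 1 := by
    have e1 : p - 1 = lam / (1 - lam) := by rw [hp]; field_simp; ring
    have e2 : q - 1 = (1 - μ) / μ := by rw [hq]; field_simp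
    rw [e1, e2, div_mul_eq_mul_div, div_lt_div_iff₀ hl1' hμ0]
    linarith
  obtain ⟨ε, hε, hεσ⟩ : ∃ ε > 0, ((p - 1) / 2 + ε) * σ₂ ^ 2 ≤ (q - 1) / 2 - ε := by
    refine ⟨(q - 1 - (p - 1) * σ₂ ^ 2) / (2 * (1 + σ₂ ^ 2)), by
      apply div_pos <;> nlinarith [sq_nonneg σ₂], ?_⟩
    have : (q - 1 - (p - 1) * σ₂ ^ 2) / (2 * (1 + σ₂ ^ 2)) * (2 * (1 + σ₂ ^ 2))
      = (q - 1 - (p - 1) * σ₂ ^ 2) := div_mul_cancel₀ _ (by positivity)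
    linarith
  set c := (q - 1) / 2 - ε with hc
  have hc0 : 0 ≤ c := le_trans (by have : 0 ≤ p - 1 := by linarith
                                   positivity) hεσ
  set A := p * ((p - 1) / 2 + ε) with hA
  set B := q * (c + ε / 2) with hB
  have hT1 := aux_taylor_le p A (by rw [hA]; nlinarith [mul_pos hp0 hε])
  have hT2 := aux_taylor_ge q B (by rw [hB, hc]; nlinarith [mul_pos hq0 hε])
  have hT3 := aux_lin q c B (by rw [hB]; nlinarith [mul_pos hq0 hε])
  -- normalisation
  let m : (Fin d → ℝ) → ℝ := fun x => (∑ i, x i) / d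
  have hm1 : m (fun _ => 1) = 1 := by simp [m, hd'.ne']
  have hmc : Continuous m := by fun_prop
  have hmT : Filter.Tendsto m (nhds (fun _ => 1)) (nhds 1) := by
    have := hmc.tendsto (fun _ => 1)
    rwa [hm1] at this
  have hm0 : ∀ᶠ x in nhds (fun _ : Fin d => (1 : ℝ)), 0 < m x :=
    hmT.eventually (lt_mem_nhds one_pos)
  let H : (Fin d → ℝ) → Fin d → ℝ := fun x i => x i / m x - 1
  have hHT : Filter.Tendsto H (nhds (fun _ => 1)) (nhds 0) := by
    rw [tendsto_pi_nhds]
    intro i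
    have h1 : Filter.Tendsto (fun x : Fin d → ℝ => x i) (nhds (fun _ => 1)) (nhds 1) :=
      (continuous_apply i).tendsto (fun _ => (1 : ℝ))
    have := (h1.div hmT one_ne_zero).sub_const 1
    simpa [H] using this
  have key : ∀ᶠ h : Fin d → ℝ in nhds 0,
      (∀ i, 0 < 1 + h i) ∧ (∀ i, 0 < 1 + C.mulVec h i) ∧
      (∀ i, (1 + C.mulVec h i) ^ p ≤ 1 + p * C.mulVec h i + A * C.mulVec h i ^ 2) ∧
      (∀ i, 1 + q * h i + B * h i ^ 2 ≤ (1 + h i) ^ q) ∧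
      (0 ≤ (∑ i, h i ^ 2) / d → (1 + c * ((∑ i, h i ^ 2) / d)) ^ q
        ≤ 1 + B * ((∑ i, h i ^ 2) / d)) := by
    have t1 : ∀ i, Filter.Tendsto (fun h : Fin d → ℝ => h i) (nhds 0) (nhds 0) := fun i =>
      (continuous_apply i).tendsto (0 : Fin d → ℝ)
    have t2 : ∀ i, Filter.Tendsto (fun h : Fin d → ℝ => C.mulVec h i) (nhds 0) (nhds 0) := by
      intro i
      have : Continuous (fun h : Fin d → ℝ => C.mulVec h i) := by
        unfold Matrix.mulVec dotProduct; fun_prop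
      simpa using this.tendsto 0
    have t3 : Filter.Tendsto (fun h : Fin d → ℝ => (∑ i, h i ^ 2) / d) (nhds 0) (nhds 0) := by
      have : Continuous (fun h : Fin d → ℝ => (∑ i, h i ^ 2) / d) := by fun_prop
      simpa using this.tendsto 0
    have hp : ∀ᶠ y : ℝ in nhds 0, 0 < 1 + y := by
      filter_upwards [lt_mem_nhds (show (-1 : ℝ) < 0 by norm_num)] with y hy
      linarith
    refine (Filter.eventually_all.2 fun i => (t1 i).eventually hp).and
      ((Filter.eventually_all.2 fun i => (t2 i).eventually hp).and
      ((Filter.eventually_all.2 fun i => (t2 i).eventually hT1).and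
      ((Filter.eventually_all.2 fun i => (t1 i).eventually hT2).and (t3.eventually hT3))))
  filter_upwards [hm0, hHT.eventually key] with x hmx ⟨k1, k2, k3, k4, k5⟩
  set h := H x with hh
  have hx : x = fun i => m x * (1 + h i) := by
    funext i
    simp only [hh, H]
    field_simp
    ring
  have hh0 : ∑ i, h i = 0 := by
    simp only [hh, H, Finset.sum_sub_distrib, ← Finset.sum_div]
    have : ∑ i, x i = d * m x := by simp only [m]; field_simp
    rw [this]
    simp [hmx.ne']
  have hC1 : C.mulVec (fun _ => 1) = fun _ => 1 := by
    funext i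
    simp [Matrix.mulVec, dotProduct, hrow]
  have hCx : C.mulVec x = fun i => m x * (1 + C.mulVec h i) := by
    conv_lhs => rw [hx]
    funext i
    simp only [Matrix.mulVec, dotProduct]
    have e : (1 : ℝ) + ∑ j, C i j * h j = ∑ j, C i j * (1 + h j) := by
      simp only [mul_add, mul_one, Finset.sum_add_distrib, hrow i]
    rw [e, Finset.mul_sum]
    exact Finset.sum_congr rfl fun j _ => by ring
  have hCh0 : ∑ i, C.mulVec h i = 0 := by
    simp only [Matrix.mulVec, dotProduct]
    rw [Finset.sum_comm]
    simp only [← Finset.sum_mul, hcol, one_mul, hh0]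
  set t := (∑ i, h i ^ 2) / d with ht
  have ht0 : 0 ≤ t := div_nonneg (Finset.sum_nonneg fun i _ => sq_nonneg _) hd'.le
  have hr0 : 0 ≤ c * t := mul_nonneg hc0 ht0
  have hsum : ∑ i, h i ^ 2 = d * t := by rw [ht]; field_simp
  have hA0 : 0 ≤ A := by
    rw [hA]
    have : 0 ≤ p - 1 := by linarith
    positivity
  have hu := aux_upper hd p A (c * t) hp0 hr0 (C.mulVec h) hCh0 k2 k3 (by
    calc A * ∑ i, C.mulVec h i ^ 2 ≤ A * (σ₂ ^ 2 * (d * t)) := by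
          rw [← hsum]
          exact mul_le_mul_of_nonneg_left (aux_sigma C hnn hrow hcol σ₂ hσ₂ h hh0) hA0
      _ = (p * (d * t)) * (((p - 1) / 2 + ε) * σ₂ ^ 2) := by rw [hA]; ring
      _ ≤ (p * (d * t)) * c := mul_le_mul_of_nonneg_left hεσ (by positivity)
      _ = _ := by ring) hp1
  have hl := aux_lower hd q B (c * t) hq0 hr0 h hh0 k1 k4 (k5 ht0)
  show vecPNormR p (C.mulVec x) / vecPNormR q x ≤
    vecPNormR p (C.mulVec fun _ => 1) / vecPNormR q (fun _ => 1)
  have eq1 : vecPNormR q x = m x * vecPNormR q (fun i => 1 + h i) := by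
    rw [← aux_hom q (m x) hq0 hmx, ← hx]
  rw [hCx, hC1, eq1, aux_hom p (m x) hp0 hmx, aux_one, aux_one, mul_div_mul_left _ _ hmx.ne']
  have hdq : 0 < (d : ℝ) ^ (1 / q) := by positivity
  have hdp : 0 < (d : ℝ) ^ (1 / p) := by positivity
  rw [div_le_div_iff₀ (lt_of_lt_of_le (by positivity) hl) hdq]
  calc _ ≤ ((d : ℝ) ^ (1 / p) * (1 + c * t)) * (d : ℝ) ^ (1 / q) :=
        mul_le_mul_of_nonneg_right hu hdq.le
    _ = (d : ℝ) ^ (1 / p) * ((d : ℝ) ^ (1 / q) * (1 + c * t)) := by ring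
    _ ≤ _ := mul_le_mul_of_nonneg_left hl hdp.le
end

section
/- (Uncertainty relation for separable states.) Let X_A, Y_A be projective measurements on ℂ^{d_A} and X_B, Y_B projective measurements on ℂ^{d_B}, with overlap matrices C_A (entries tr(X_{A,i} Y_{A,j})) and C_B (entries tr(X_{B,k} Y_{B,l})). Let X_{AB} = (X_{A,i} ⊗ X_{B,k})_{i,k} and Y_{AB} = (Y_{A,j} ⊗ Y_{B,l})_{j,l} be the corresponding product measurements on ℂ^{d_A} ⊗ ℂ^{d_B}. Let ρ_{AB} = ∑_{i∈I} p_i (ρ_i^A ⊗ ρ_i^B) be a separable state, where I is finite, p is a probability vector, ρ_i^A and ρ_i^B are density matrices, and ⊗ is the Kronecker product; write ρ_A = ∑_i p_i ρ_i^A and ρ_B = ∑_i p_i ρ_i^B. Then for all 0 < μ ≤ 1 and 0 ≤ λ < 1: λ·H(X_{AB})_{ρ_{AB}} + μ·H(Y_{AB})_{ρ_{AB}} ≥ max(S(ρ_A), S(ρ_B)) − log ‖C_A‖_{(1/μ)→(1/(1−λ))} − log ‖C_B‖_{(1/μ)→(1/(1−λ))}. -/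
open scoped BigOperators Kronecker ComplexOrder

namespace SepUR

lemma gibbs {ι : Type*} [Fintype ι] (q b : ι → ℝ) (hq : ∀ j, 0 ≤ q j) (hq1 : ∑ j, q j = 1)
    (hb : ∀ j, 0 ≤ b j) (hqb : ∀ j, 0 < q j → 0 < b j) :
    0 < ∑ j, b j ∧ ∑ j, q j * (Real.log (b j) - Real.log (q j)) ≤ Real.log (∑ j, b j) := by
  have hpos : 0 < ∑ j, b j := by
    have : ∃ j, 0 < q j := by
      by_contra! h
      have : ∑ j, q j ≤ 0 := Finset.sum_nonpos fun j _ => h j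
      linarith
    obtain ⟨j, hj⟩ := this
    exact Finset.sum_pos' (fun j _ => hb j) ⟨j, Finset.mem_univ _, hqb j hj⟩
  refine ⟨hpos, ?_⟩
  set B := ∑ j, b j with hB
  have key : ∀ j, q j * (Real.log (b j) - Real.log (q j)) ≤ q j * Real.log B + (b j / B - q j) := by
    intro j
    rcases (hq j).eq_or_lt with h | h
    · rw [← h]
      have := div_nonneg (hb j) hpos.le
      simp only [zero_mul]; linarith
    · have hbj := hqb j h
      have h1 := Real.log_le_sub_one_of_pos (x := b j / (q j * B)) (by positivity)
      rw [Real.log_div hbj.ne' (by positivity), Real.log_mul h.ne' hpos.ne'] at h1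
      have h2 := mul_le_mul_of_nonneg_left h1 h.le
      have h3 : q j * (b j / (q j * B) - 1) = b j / B - q j := by field_simp
      rw [h3] at h2
      linarith
  calc _ ≤ ∑ j, (q j * Real.log B + (b j / B - q j)) := Finset.sum_le_sum fun j _ => key j
    _ = Real.log B := by
      rw [Finset.sum_add_distrib, Finset.sum_sub_distrib, ← Finset.sum_mul, ← Finset.sum_div, hq1,
        ← hB, div_self hpos.ne']; ring

lemma hsh {ι : Type*} [Fintype ι] (f : ι → ℝ) :
    shannonEntropy f = ∑ i, Real.negMulLog (f i) := by
  simp [shannonEntropy, Real.negMulLog, Finset.sum_neg_distrib]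

lemma chain {κ α β : Type*} [Fintype κ] [Fintype α] [Fintype β] (p : κ → ℝ) (a : κ → α → ℝ)
    (b : κ → β → ℝ) (hp : ∀ i, 0 ≤ p i) (ha : ∀ i x, 0 ≤ a i x) (hb : ∀ i y, 0 ≤ b i y)
    (ha1 : ∀ i, ∑ x, a i x = 1) (hb1 : ∀ i, ∑ y, b i y = 1) :
    shannonEntropy (fun x => ∑ i, p i * a i x) + ∑ i, p i * shannonEntropy (b i)
      ≤ shannonEntropy (fun xy : α × β => ∑ i, p i * (a i xy.1 * b i xy.2)) := by
  have key : ∀ x y, ∑ i, p i * a i x * Real.negMulLog (b i y)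
      - (∑ i, p i * (a i x * b i y)) * Real.log (∑ i, p i * a i x)
      ≤ Real.negMulLog (∑ i, p i * (a i x * b i y)) := by
    intro x y
    have hnn : ∀ i, 0 ≤ p i * a i x := fun i => mul_nonneg (hp i) (ha i x)
    rcases (Finset.sum_nonneg fun i (_ : i ∈ Finset.univ) => hnn i).eq_or_lt with h | h
    · have h0 := (Finset.sum_eq_zero_iff_of_nonneg fun i _ => hnn i).1 h.symm
      have h1 : ∀ i, p i * (a i x * b i y) = 0 := fun i => by
        rw [← mul_assoc, h0 i (Finset.mem_univ _), zero_mul]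
      have h2 : ∀ i, p i * a i x = 0 := fun i => h0 i (Finset.mem_univ _)
      simp [h1, h2]
    · set A := ∑ i, p i * a i x with hA
      have hj := Real.concaveOn_negMulLog.le_map_sum (t := Finset.univ)
        (w := fun i => p i * a i x / A) (p := fun i => b i y)
        (fun i _ => div_nonneg (hnn i) h.le) (by rw [← Finset.sum_div, ← hA, div_self h.ne'])
        (fun i _ => hb i y)
      simp only [smul_eq_mul] at hj
      have e1 : ∑ i, p i * a i x / A * b i y = (∑ i, p i * (a i x * b i y)) / A := by
        rw [Finset.sum_div]; exact Finset.sum_congr rfl fun i _ => by ring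
      have e2 : ∑ i, p i * a i x / A * Real.negMulLog (b i y)
          = (∑ i, p i * a i x * Real.negMulLog (b i y)) / A := by
        rw [Finset.sum_div]; exact Finset.sum_congr rfl fun i _ => by ring
      rw [e1, e2, div_le_iff₀ h] at hj
      set P := ∑ i, p i * (a i x * b i y) with hP
      have e3 : Real.negMulLog (P / A) * A = Real.negMulLog P + P * Real.log A := by
        by_cases hP0 : P = 0
        · simp [hP0]
        · simp only [Real.negMulLog]
          rw [Real.log_div hP0 h.ne']; field_simp; ring
      linarith
  have e := Finset.sum_le_sum fun x (_ : x ∈ Finset.univ) =>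
    Finset.sum_le_sum fun y (_ : y ∈ Finset.univ) => key x y
  rw [hsh (fun xy : α × β => ∑ i, p i * (a i xy.1 * b i xy.2)), Fintype.sum_prod_type]
  refine le_trans (le_of_eq ?_) e
  simp only [hsh, Finset.sum_sub_distrib]
  have e1 : ∑ x, ∑ y, ∑ i, p i * a i x * Real.negMulLog (b i y)
      = ∑ i, p i * ∑ y, Real.negMulLog (b i y) := by
    have : ∀ x, ∑ y, ∑ i, p i * a i x * Real.negMulLog (b i y)
        = ∑ i, a i x * (p i * ∑ y, Real.negMulLog (b i y)) := by
      intro x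
      rw [Finset.sum_comm]
      refine Finset.sum_congr rfl fun i _ => ?_
      rw [← Finset.mul_sum]; ring
    rw [Finset.sum_congr rfl fun x _ => this x, Finset.sum_comm]
    refine Finset.sum_congr rfl fun i _ => ?_
    rw [← Finset.sum_mul, ha1, one_mul]
  have e2 : ∀ x, ∑ y, (∑ i, p i * (a i x * b i y)) * Real.log (∑ i, p i * a i x)
      = - Real.negMulLog (∑ i, p i * a i x) := by
    intro x
    rw [← Finset.sum_mul, Finset.sum_comm]
    have : ∀ i, ∑ y, p i * (a i x * b i y) = p i * a i x := fun i => by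
      rw [← Finset.mul_sum, ← Finset.mul_sum, hb1, mul_one]
    simp only [this, Real.negMulLog]; ring
  rw [e1, Finset.sum_congr rfl fun x _ => e2 x, Finset.sum_neg_distrib]; ring

/-- integration step -/
lemma integrate {K I J : Type*} [Fintype K] [Fintype I] [Fintype J]
    (m : K → I → ℝ) (r : K → ℝ) (a : I → ℝ) (q s : J → ℝ)
    (hm1 : ∀ k, ∑ i, m k i = 1) (hr : ∀ k, 0 ≤ r k) (hr1 : ∑ k, r k = 1)
    (ha : ∀ i, 0 < a i) (hq : ∀ j, 0 ≤ q j) (hq1 : ∑ j, q j = 1) (hs : ∀ j, 0 ≤ s j)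
    (hqs : ∀ j, 0 < q j → 0 < s j)
    (hcore : ∀ t, 0 ≤ t → ∑ j, q j ^ 2 / (s j + t * q j)
      ≤ ∑ k, ∑ i, m k i * r k ^ 2 / (a i + t * r k)) :
    ∑ j, q j * (Real.log (q j) - Real.log (s j))
      ≤ ∑ k, r k * Real.log (r k) - ∑ i, (∑ k, r k * m k i) * Real.log (a i) := by
  let F : ℝ → ℝ := fun t => ∑ k, ∑ i, m k i * r k * (Real.log (a i + t * r k) - Real.log (a i))
    - ∑ j, q j * (Real.log (s j + t * q j) - Real.log (s j))
  have hd : ∀ t, 0 ≤ t → HasDerivAt F (∑ k, ∑ i, m k i * r k ^ 2 / (a i + t * r k)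
      - ∑ j, q j ^ 2 / (s j + t * q j)) t := by
    intro t ht
    refine HasDerivAt.sub (HasDerivAt.fun_sum fun k _ => HasDerivAt.fun_sum fun i _ => ?_)
      (HasDerivAt.fun_sum fun j _ => ?_)
    · have hne : a i + t * r k ≠ 0 := by
        have := ha i; have := hr k; positivity
      have h1 : HasDerivAt (fun t => a i + t * r k) (r k) t := by
        simpa using ((hasDerivAt_id t).mul_const (r k)).const_add (a i)
      have := ((h1.log hne).sub_const (Real.log (a i))).const_mul (m k i * r k)
      exact this.congr_deriv (by ring)
    · rcases (hq j).eq_or_lt with h | h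
      · simp only [← h]; simpa using hasDerivAt_const t (0:ℝ)
      · have hne : s j + t * q j ≠ 0 := by
          have := hqs j h; positivity
        have h1 : HasDerivAt (fun t => s j + t * q j) (q j) t := by
          simpa using ((hasDerivAt_id t).mul_const (q j)).const_add (s j)
        have := ((h1.log hne).sub_const (Real.log (s j))).const_mul (q j)
        exact this.congr_deriv (by ring)
  have hmono : MonotoneOn F (Set.Ici 0) := by
    refine monotoneOn_of_deriv_nonneg (convex_Ici 0)
      (fun t ht => (hd t ht).continuousAt.continuousWithinAt)
      (fun t ht => (hd t (interior_subset ht)).differentiableAt.differentiableWithinAt) ?_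
    intro t ht
    rw [(hd t (interior_subset ht)).deriv]
    exact sub_nonneg.2 (hcore t (interior_subset ht))
  have hF0 : F 0 = 0 := by simp [F]
  -- for every e > 0
  have hstep : ∀ e : ℝ, 0 < e → ∑ j, q j * (Real.log (q j) - Real.log (s j))
      ≤ ∑ k, ∑ i, m k i * (r k * Real.log (r k + e * a i)) 
        - ∑ i, (∑ k, r k * m k i) * Real.log (a i) := by
    intro e he
    have hF : 0 ≤ F e⁻¹ := by
      rw [← hF0]; exact hmono (by simp) (by simpa using he.le) (by positivity)
    have e1 : ∀ k i, m k i * r k * (Real.log (a i + e⁻¹ * r k) - Real.log (a i))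
        = m k i * (r k * Real.log (r k + e * a i)) - r k * m k i * Real.log (a i)
          - m k i * (r k * Real.log e) := by
      intro k i
      have hne : r k + e * a i ≠ 0 := by
        have := ha i; have := hr k; positivity
      have : a i + e⁻¹ * r k = (r k + e * a i) / e := by field_simp; ring
      rw [this, Real.log_div hne he.ne']; ring
    have e2 : ∀ j, q j * (Real.log (q j) - Real.log (s j)) - q j * Real.log e
        ≤ q j * (Real.log (s j + e⁻¹ * q j) - Real.log (s j)) := by
      intro j
      rcases (hq j).eq_or_lt with h | h
      · simp [← h]
      · have : s j + e⁻¹ * q j = (q j + e * s j) / e := by field_simp; ring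
        have hsj := hqs j h
        rw [this, Real.log_div (by positivity) he.ne']
        have := Real.log_le_log h (show q j ≤ q j + e * s j by
          have := mul_pos he hsj; linarith)
        nlinarith [mul_le_mul_of_nonneg_left this h.le]
    have e3 := Finset.sum_le_sum fun j (_ : j ∈ Finset.univ) => e2 j
    rw [Finset.sum_sub_distrib, ← Finset.sum_mul, hq1] at e3
    simp only [F, e1, Finset.sum_sub_distrib] at hF
    have e4 : ∑ k, ∑ i, m k i * (r k * Real.log e) = Real.log e := by
      simp only [← Finset.sum_mul, hm1, one_mul, hr1]
    have e5 : ∑ k, ∑ i, r k * m k i * Real.log (a i)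
        = ∑ i, (∑ k, r k * m k i) * Real.log (a i) := by
      rw [Finset.sum_comm]; simp only [Finset.sum_mul]
    rw [e4, e5] at hF
    have e6 : ∑ j, q j * (Real.log (s j + e⁻¹ * q j) - Real.log (s j)) = 
      ∑ j, q j * Real.log (s j + e⁻¹ * q j) - ∑ j, q j * Real.log (s j) := by
      rw [← Finset.sum_sub_distrib]; simp only [mul_sub]
    simp only [mul_sub, Finset.sum_sub_distrib] at e3 hF e6 ⊢
    linarith
  have hlim : Filter.Tendsto (fun e : ℝ => ∑ k, ∑ i, m k i * (r k * Real.log (r k + e * a i)) 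
        - ∑ i, (∑ k, r k * m k i) * Real.log (a i)) (nhdsWithin 0 (Set.Ioi 0))
      (nhds (∑ k, r k * Real.log (r k) - ∑ i, (∑ k, r k * m k i) * Real.log (a i))) := by
    have e0 : ∑ k, r k * Real.log (r k) = ∑ k, ∑ i, m k i * (r k * Real.log (r k)) := by
      simp only [← Finset.sum_mul, hm1, one_mul]
    rw [e0]
    refine Filter.Tendsto.sub_const (tendsto_finsetSum _ fun k _ => tendsto_finsetSum _ fun i _ => 
      Filter.Tendsto.const_mul _ ?_) _
    rcases (hr k).eq_or_lt with h | h
    · simp [← h]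
    · have : ContinuousAt (fun e : ℝ => r k * Real.log (r k + e * a i)) 0 := by
        refine ContinuousAt.mul continuousAt_const (ContinuousAt.log (by fun_prop) ?_)
        simpa using h.ne'
      have h2 := this.tendsto
      simp only [zero_mul, add_zero] at h2
      exact h2.mono_left nhdsWithin_le_nhds
  exact ge_of_tendsto hlim (Filter.eventually_of_mem self_mem_nhdsWithin fun e he => hstep e he)

end SepUR

namespace SepUR

open Matrix

structure IsPM {n d : ℕ} (X : Fin n → Matrix (Fin d) (Fin d) ℂ) : Prop where
  herm : ∀ i, (X i).IsHermitian
  proj : ∀ i, X i * X i = X i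
  orth : ∀ i j, i ≠ j → X i * X j = 0
  sum : ∑ i, X i = 1

lemma IsPM.psd {n d : ℕ} {X : Fin n → Matrix (Fin d) (Fin d) ℂ} (h : IsPM X) (i : Fin n) :
    (X i).PosSemidef := by
  have := posSemidef_conjTranspose_mul_self (X i)
  rwa [(h.herm i).eq, h.proj i] at this

lemma core {n n' d : ℕ} {X : Fin n → Matrix (Fin d) (Fin d) ℂ}
    {Y : Fin n' → Matrix (Fin d) (Fin d) ℂ} (hX : IsPM X) (hY : IsPM Y) (r : Fin d → ℝ)
    (hr : ∀ k, 0 ≤ r k) (a : Fin n → ℝ) (ha : ∀ i, 0 < a i) (t : ℝ) (ht : 0 ≤ t) (c : Fin n' → ℝ) :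
    ∑ j, (2 * c j * (∑ k, r k * (Y j k k).re)
      - c j ^ 2 * ((∑ i, a i * (X i * Y j).trace.re) + t * (∑ k, r k * (Y j k k).re)))
    ≤ ∑ k, ∑ i, (X i k k).re * r k ^ 2 / (a i + t * r k) := by
  obtain ⟨W, hW⟩ : ∃ W, W = ∑ j, (c j : ℂ) • Y j := ⟨_, rfl⟩
  have hWh : Wᴴ = W := by
    rw [hW, conjTranspose_sum]
    refine Finset.sum_congr rfl fun j _ => ?_
    rw [conjTranspose_smul, (hY.herm j).eq]; simp
  have hWW : W * W = ∑ j, ((c j ^ 2 : ℝ) : ℂ) • Y j := by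
    rw [hW, Finset.sum_mul]
    refine Finset.sum_congr rfl fun j _ => ?_
    rw [Finset.mul_sum, Finset.sum_eq_single j]
    · rw [smul_mul_smul_comm, hY.proj]; push_cast; rw [sq]
    · intro b _ hb
      rw [smul_mul_smul_comm, hY.orth j b (Ne.symm hb), smul_zero]
    · simp
  have hterm : ∀ (α : ℝ) k i, 0 ≤ α ^ 2 * (X i k k).re - 2 * α * ((X i * W) k k).re
      + ((W * X i * W) k k).re := by
    intro α k i
    have h1 := ((hX.psd i).conjTranspose_mul_mul_same ((α : ℂ) • (1 : Matrix (Fin d) (Fin d) ℂ) - W)).diag_nonneg (i := k)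
    have h2 : ((α : ℂ) • (1 : Matrix (Fin d) (Fin d) ℂ) - W)ᴴ * X i * ((α : ℂ) • 1 - W)
      = ((α ^ 2 : ℝ) : ℂ) • X i - (α : ℂ) • (X i * W) - (α : ℂ) • (W * X i) + W * X i * W := by
      rw [conjTranspose_sub, conjTranspose_smul, hWh, conjTranspose_one]
      simp only [sub_mul, mul_sub, smul_mul_assoc, mul_smul_comm, one_mul, mul_one, smul_sub,
        smul_smul, RCLike.star_def, Complex.conj_ofReal]
      push_cast; rw [sq]; abel
    have h3 : ((W * X i) k k).re = ((X i * W) k k).re := by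
      have : W * X i = (X i * W)ᴴ := by rw [conjTranspose_mul, hWh, (hX.herm i).eq]
      rw [this, conjTranspose_apply]; simp
    rw [h2] at h1
    have h4 := (Complex.le_def.1 h1).1
    simp only [Matrix.add_apply, Matrix.sub_apply, Matrix.smul_apply, smul_eq_mul, Complex.add_re, Complex.sub_re,
      Complex.re_ofReal_mul, h3, Complex.zero_re] at h4
    linarith
  have hterm2 : ∀ k i, 2 * r k * ((X i * W) k k).re - (a i + t * r k) * ((W * X i * W) k k).re
      ≤ (X i k k).re * r k ^ 2 / (a i + t * r k) := by
    intro k i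
    have hD : 0 < a i + t * r k := by
      have := ha i; have := hr k; positivity
    have h := mul_nonneg hD.le (hterm (r k / (a i + t * r k)) k i)
    have : (a i + t * r k) * ((r k / (a i + t * r k)) ^ 2 * (X i k k).re
       - 2 * (r k / (a i + t * r k)) * ((X i * W) k k).re + ((W * X i * W) k k).re)
       = (X i k k).re * r k ^ 2 / (a i + t * r k) - 2 * r k * ((X i * W) k k).re
        + (a i + t * r k) * ((W * X i * W) k k).re := by
      field_simp
    rw [this] at h
    linarith
  refine le_trans (le_of_eq ?_) (Finset.sum_le_sum fun k _ => Finset.sum_le_sum fun i _ => hterm2 k i)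
  have s1 : ∀ k, ∑ i, ((X i * W) k k).re = ∑ j, c j * (Y j k k).re := by
    intro k
    rw [← Complex.re_sum, ← Matrix.sum_apply, ← Finset.sum_mul, hX.sum, one_mul, hW,
      Matrix.sum_apply, Complex.re_sum]
    simp
  have s2 : ∀ k, ∑ i, ((W * X i * W) k k).re = ∑ j, c j ^ 2 * (Y j k k).re := by
    intro k
    rw [← Complex.re_sum, ← Matrix.sum_apply, ← Finset.sum_mul, ← Finset.mul_sum, hX.sum, mul_one,
      hWW, Matrix.sum_apply, Complex.re_sum]
    simp only [Matrix.smul_apply, smul_eq_mul, Complex.re_ofReal_mul]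
  have s3 : ∀ i, ∑ k, ((W * X i * W) k k).re = ∑ j, c j ^ 2 * (X i * Y j).trace.re := by
    intro i
    have : ∑ k, ((W * X i * W) k k).re = (W * X i * W).trace.re := by
      rw [Matrix.trace, Complex.re_sum]; rfl
    rw [this, mul_assoc, Matrix.trace_mul_comm, mul_assoc, hWW, Finset.mul_sum, trace_sum,
      Complex.re_sum]
    refine Finset.sum_congr rfl fun j _ => ?_
    rw [mul_smul_comm, trace_smul, smul_eq_mul, Complex.re_ofReal_mul]
  have e1 : ∑ k, ∑ i, (2 * r k * ((X i * W) k k).re - (a i + t * r k) * ((W * X i * W) k k).re)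
     = ∑ k, 2 * r k * (∑ i, ((X i * W) k k).re) - ∑ i, a i * (∑ k, ((W * X i * W) k k).re)
      - ∑ k, t * r k * (∑ i, ((W * X i * W) k k).re) := by
    have : ∑ i, a i * (∑ k, ((W * X i * W) k k).re) = ∑ k, ∑ i, a i * ((W * X i * W) k k).re := by
      rw [Finset.sum_comm]; simp only [Finset.mul_sum]
    rw [this, ← Finset.sum_sub_distrib, ← Finset.sum_sub_distrib]
    refine Finset.sum_congr rfl fun k _ => ?_
    rw [Finset.mul_sum, Finset.mul_sum, ← Finset.sum_sub_distrib, ← Finset.sum_sub_distrib]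
    exact Finset.sum_congr rfl fun i _ => by ring
  rw [e1]
  simp only [s1, s2, s3, Finset.mul_sum]
  rw [Finset.sum_comm (f := fun k j => 2 * r k * (c j * (Y j k k).re)),
    Finset.sum_comm (f := fun k j => t * r k * (c j ^ 2 * (Y j k k).re)),
    Finset.sum_comm (f := fun i j => a i * (c j ^ 2 * (X i * Y j).trace.re)),
    ← Finset.sum_sub_distrib, ← Finset.sum_sub_distrib]
  refine Finset.sum_congr rfl fun j _ => ?_
  rw [mul_add, sub_sub]
  simp only [Finset.mul_sum]
  congr 1
  · exact Finset.sum_congr rfl fun k _ => by ring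
  · congr 1
    · exact Finset.sum_congr rfl fun k _ => by ring
    · exact Finset.sum_congr rfl fun k _ => by ring

lemma IsPM.tr_nonneg {n n' d : ℕ} {X : Fin n → Matrix (Fin d) (Fin d) ℂ}
    {Y : Fin n' → Matrix (Fin d) (Fin d) ℂ} (hX : IsPM X) (hY : IsPM Y) (i : Fin n) (j : Fin n') :
    0 ≤ (X i * Y j).trace.re := by
  have h1 := ((hX.psd i).conjTranspose_mul_mul_same (Y j)).trace_nonneg
  rw [(hY.herm j).eq, Matrix.trace_mul_comm, ← mul_assoc, hY.proj, Matrix.trace_mul_comm] at h1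
  exact (Complex.le_def.1 h1).1

/-- The single system inequality, for a diagonal state and general weights. -/
lemma single_diag {n n' d : ℕ} {X : Fin n → Matrix (Fin d) (Fin d) ℂ}
    {Y : Fin n' → Matrix (Fin d) (Fin d) ℂ} (hX : IsPM X) (hY : IsPM Y) (r : Fin d → ℝ)
    (hr : ∀ k, 0 ≤ r k) (hr1 : ∑ k, r k = 1) (a : Fin n → ℝ) (ha : ∀ i, 0 < a i)
    (q : Fin n' → ℝ) (hq : ∀ j, q j = ∑ k, r k * (Y j k k).re) (μ : ℝ) :
    (∀ j, 0 ≤ q j) ∧ ∑ j, q j = 1 ∧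
    Real.exp (-(- (∑ i, (∑ k, r k * (X i k k).re) * Real.log (a i))
      - μ * ∑ j, q j * Real.log (q j) + ∑ k, r k * Real.log (r k)))
      ≤ ∑ j, (∑ i, a i * (X i * Y j).trace.re) * q j ^ μ := by
  have hYd : ∀ j k, 0 ≤ (Y j k k).re := fun j k => 
    (Complex.le_def.1 ((hY.psd j).diag_nonneg (i := k))).1
  have hq0 : ∀ j, 0 ≤ q j := fun j => by
    rw [hq]; exact Finset.sum_nonneg fun k _ => mul_nonneg (hr k) (hYd j k)
  have hPM1 : ∀ {n : ℕ} {Z : Fin n → Matrix (Fin d) (Fin d) ℂ}, IsPM Z → ∀ k, 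
      ∑ i, (Z i k k).re = 1 := by
    intro n Z hZ k
    rw [← Complex.re_sum, ← Matrix.sum_apply, hZ.sum]; simp
  have hq1 : ∑ j, q j = 1 := by
    simp only [hq]
    rw [Finset.sum_comm]
    simp only [← Finset.mul_sum, hPM1 hY, mul_one, hr1]
  refine ⟨hq0, hq1, ?_⟩
  obtain ⟨s, hs⟩ : ∃ s : Fin n' → ℝ, ∀ j, s j = ∑ i, a i * (X i * Y j).trace.re := ⟨_, fun _ => rfl⟩
  have hs0 : ∀ j, 0 ≤ s j := fun j => by
    rw [hs]; exact Finset.sum_nonneg fun i _ => mul_nonneg (ha i).le (hX.tr_nonneg hY i j)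
  have hqs : ∀ j, 0 < q j → 0 < s j := by
    intro j hj
    refine (hs0 j).lt_of_ne' fun h0 => ?_
    rw [hs, Finset.sum_eq_zero_iff_of_nonneg
      fun i _ => mul_nonneg (ha i).le (hX.tr_nonneg hY i j)] at h0
    have h1 : ∑ i, (X i * Y j).trace.re = 0 := Finset.sum_eq_zero fun i hi => by
      have := h0 i hi
      simpa [(ha i).ne'] using this
    rw [← Complex.re_sum, ← trace_sum, ← Finset.sum_mul, hX.sum, one_mul, Matrix.trace,
      Complex.re_sum] at h1
    simp only [Matrix.diag_apply] at h1
    rw [Finset.sum_eq_zero_iff_of_nonneg fun k _ => hYd j k] at h1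
    rw [hq, Finset.sum_eq_zero fun k hk => by rw [h1 k hk, mul_zero]] at hj
    exact lt_irrefl _ hj
  have hint := integrate (fun k i => (X i k k).re) r a q s (hPM1 hX) hr hr1 ha hq0 hq1 hs0 hqs (by
    intro t ht
    have hc := core hX hY r hr a ha t ht (fun j => q j / (s j + t * q j))
    refine le_trans (Finset.sum_le_sum fun j _ => ?_) hc
    rw [← hq, ← hs]
    by_cases hD : s j + t * q j = 0
    · simp [hD]
    · apply le_of_eq; field_simp; ring)
  have hg := gibbs q (fun j => s j * q j ^ μ) hq0 hq1
    (fun j => mul_nonneg (hs0 j) (Real.rpow_nonneg (hq0 j) _))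
    (fun j hj => mul_pos (hqs j hj) (Real.rpow_pos_of_pos hj _))
  simp only [← hs]
  rw [← Real.le_log_iff_exp_le hg.1]
  refine le_trans ?_ hg.2
  have e1 : ∀ j, q j * (Real.log (s j * q j ^ μ) - Real.log (q j))
     = -(q j * (Real.log (q j) - Real.log (s j))) + μ * (q j * Real.log (q j)) := by
    intro j
    rcases (hq0 j).eq_or_lt with h | h
    · simp [← h]
    · rw [Real.log_mul (hqs j h).ne' (Real.rpow_pos_of_pos h _).ne', Real.log_rpow h]; ring
  simp only [e1, Finset.sum_add_distrib, Finset.sum_neg_distrib, ← Finset.mul_sum]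
  linarith

lemma norm_bound {n n' : ℕ} (C : Matrix (Fin n) (Fin n') ℝ) (hC : ∀ i j, 0 ≤ C i j)
    (p : Fin n → ℝ) (hp : ∀ i, 0 ≤ p i) (hp1 : ∑ i, p i = 1)
    (q : Fin n' → ℝ) (hq : ∀ i, 0 ≤ q i) (hq1 : ∑ i, q i = 1)
    (μ lam : ℝ) (hμ0 : 0 < μ) (hlam0 : 0 ≤ lam) (hlam1 : lam < 1) :
    ∑ j, (∑ i, p i ^ lam * C i j) * q j ^ μ
      ≤ matPNorm (1 / μ) (1 / (1 - lam)) (C.map Complex.ofReal) := by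
  have h1l : 0 < 1 - lam := by linarith
  obtain ⟨S, hS⟩ : ∃ S, S = 1 / (1 - lam) := ⟨_, rfl⟩
  obtain ⟨R, hR⟩ : ∃ R, R = 1 / μ := ⟨_, rfl⟩
  have hS0 : 0 < S := by rw [hS]; positivity
  have hR0 : 0 < R := by rw [hR]; positivity
  obtain ⟨φ, hφ⟩ : ∃ φ : Fin n' → ℂ, φ = fun j => ((q j ^ μ : ℝ) : ℂ) := ⟨_, rfl⟩
  have hqμ : ∀ j, 0 ≤ q j ^ μ := fun j => Real.rpow_nonneg (hq j) _
  have hφn : vecPNorm R φ = 1 := by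
    have : ∀ j, ‖φ j‖ ^ R = q j := fun j => by
      rw [hφ]; simp only [Complex.norm_real, Real.norm_eq_abs]
      rw [abs_of_nonneg (hqμ j), ← Real.rpow_mul (hq j), hR, mul_one_div_cancel hμ0.ne', Real.rpow_one]
    simp [vecPNorm, this, hq1]
  have hφ0 : φ ≠ 0 := by
    rintro h
    rw [h] at hφn
    simp [vecPNorm, Real.zero_rpow hR0.ne'] at hφn
    rw [Real.zero_rpow (by positivity)] at hφn
    exact zero_ne_one hφn
  have hbdd : BddAbove {t : ℝ | ∃ φ : Fin n' → ℂ, φ ≠ 0 ∧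
      t = vecPNorm S ((C.map Complex.ofReal).mulVec φ) / vecPNorm R φ} := by
    refine ⟨(∑ i, (∑ j, C i j) ^ S) ^ (1 / S), ?_⟩
    rintro t ⟨ψ, hψ, rfl⟩
    have hN : 0 ≤ vecPNorm R ψ := by unfold vecPNorm; positivity
    refine div_le_of_le_mul₀ hN (by
      have : ∀ i, 0 ≤ ∑ j, C i j := fun i => Finset.sum_nonneg fun j _ => hC i j
      exact Real.rpow_nonneg (Finset.sum_nonneg fun i _ => Real.rpow_nonneg (this i) _) _) ?_
    have hj : ∀ j, ‖ψ j‖ ≤ vecPNorm R ψ := by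
      intro j
      have h1 : ‖ψ j‖ ^ R ≤ ∑ j, ‖ψ j‖ ^ R :=
        Finset.single_le_sum (f := fun j => ‖ψ j‖ ^ R) (fun _ _ => by positivity) (Finset.mem_univ j)
      have h2 := Real.rpow_le_rpow (by positivity) h1 (show 0 ≤ 1 / R by positivity)
      rwa [← Real.rpow_mul (norm_nonneg _), mul_one_div_cancel hR0.ne', Real.rpow_one] at h2
    have hi : ∀ i, ‖(C.map Complex.ofReal).mulVec ψ i‖ ≤ (∑ j, C i j) * vecPNorm R ψ := by
      intro i
      rw [Matrix.mulVec, dotProduct, Finset.sum_mul]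
      refine (norm_sum_le _ _).trans (Finset.sum_le_sum fun j _ => ?_)
      rw [norm_mul, Matrix.map_apply, Complex.norm_real, Real.norm_eq_abs, abs_of_nonneg (hC i j)]
      exact mul_le_mul_of_nonneg_left (hj j) (hC i j)
    have h0 : ∀ i, 0 ≤ ∑ j, C i j := fun i => Finset.sum_nonneg fun j _ => hC i j
    calc vecPNorm S ((C.map Complex.ofReal).mulVec ψ)
        ≤ (∑ i, ((∑ j, C i j) * vecPNorm R ψ) ^ S) ^ (1 / S) := by
          unfold vecPNorm
          refine Real.rpow_le_rpow (by positivity) (Finset.sum_le_sum fun i _ => ?_) (by positivity)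
          exact Real.rpow_le_rpow (norm_nonneg _) (hi i) hS0.le
      _ = _ := by
          simp only [fun i => Real.mul_rpow (h0 i) hN (z := S)]
          rw [← Finset.sum_mul, Real.mul_rpow
            (Finset.sum_nonneg fun i _ => Real.rpow_nonneg (h0 i) _) (Real.rpow_nonneg hN _),
            ← Real.rpow_mul hN, mul_one_div_cancel hS0.ne', Real.rpow_one]
  have hle : vecPNorm S ((C.map Complex.ofReal).mulVec φ) ≤ matPNorm R S (C.map Complex.ofReal) := by
    refine le_csSup hbdd ⟨φ, hφ0, ?_⟩
    rw [hφn, div_one]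
  rw [← hS, ← hR]
  refine le_trans ?_ hle
  obtain ⟨g, hg⟩ : ∃ g : Fin n → ℝ, ∀ i, g i = ∑ j, C i j * q j ^ μ := ⟨_, fun _ => rfl⟩
  have hg0 : ∀ i, 0 ≤ g i := fun i => by
    rw [hg]; exact Finset.sum_nonneg fun j _ => mul_nonneg (hC i j) (hqμ j)
  have hgn : vecPNorm S ((C.map Complex.ofReal).mulVec φ) = (∑ i, g i ^ S) ^ (1 / S) := by
    unfold vecPNorm
    congr 1
    refine Finset.sum_congr rfl fun i _ => ?_
    congr 1
    have : (C.map Complex.ofReal).mulVec φ i = (g i : ℂ) := by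
      rw [Matrix.mulVec, dotProduct, hg, hφ]; push_cast; rfl
    rw [this, Complex.norm_real, Real.norm_eq_abs, abs_of_nonneg (hg0 i)]
  rw [hgn]
  have e1 : ∑ j, (∑ i, p i ^ lam * C i j) * q j ^ μ = ∑ i, p i ^ lam * g i := by
    simp only [hg, Finset.sum_mul, Finset.mul_sum]
    rw [Finset.sum_comm]
    exact Finset.sum_congr rfl fun i _ => Finset.sum_congr rfl fun j _ => by ring
  rw [e1]
  rcases hlam0.eq_or_lt with h | h
  · have : S = 1 := by rw [hS, ← h]; norm_num
    simp [← h, this]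
  · have hconj : (1 / lam).HolderConjugate S := by
      rw [Real.holderConjugate_iff]
      refine ⟨by rw [lt_div_iff₀ h]; linarith, ?_⟩
      rw [hS]; field_simp; ring
    have := Real.inner_le_Lp_mul_Lq_of_nonneg Finset.univ (f := fun i => p i ^ lam) (g := g) hconj
      (fun i _ => Real.rpow_nonneg (hp i) _) (fun i _ => hg0 i)
    refine this.trans (le_of_eq ?_)
    have e2 : ∀ i, (p i ^ lam) ^ (1 / lam) = p i := fun i => by
      rw [← Real.rpow_mul (hp i), mul_one_div_cancel h.ne', Real.rpow_one]
    simp [e2, hp1, -one_div]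

end SepUR

namespace SepUR

open Matrix

lemma IsPM.conj {n d : ℕ} {X : Fin n → Matrix (Fin d) (Fin d) ℂ} (h : IsPM X)
    (V : Matrix (Fin d) (Fin d) ℂ) (hV : V * Vᴴ = 1) (hV' : Vᴴ * V = 1) :
    IsPM (fun i => Vᴴ * X i * V) := by
  have hm : ∀ i j, Vᴴ * X i * V * (Vᴴ * X j * V) = Vᴴ * (X i * X j) * V := by
    intro i j
    calc _ = Vᴴ * X i * (V * Vᴴ) * X j * V := by simp only [mul_assoc]
      _ = _ := by rw [hV]; simp only [mul_assoc, one_mul]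
  refine ⟨fun i => ?_, fun i => ?_, fun i j hij => ?_, ?_⟩
  · exact isHermitian_conjTranspose_mul_mul V (h.herm i)
  · simp only [hm, h.proj]
  · simp only [hm, h.orth i j hij, mul_zero, zero_mul]
  · rw [← Finset.sum_mul, ← Finset.mul_sum, h.sum, mul_one, hV']

lemma eig_facts {d : ℕ} {ρ : Matrix (Fin d) (Fin d) ℂ} (hρ : ρ.PosSemidef) (ht : ρ.trace = 1) :
    (∀ k, 0 ≤ hρ.1.eigenvalues k) ∧ ∑ k, hρ.1.eigenvalues k = 1 := by
  refine ⟨fun k => hρ.eigenvalues_nonneg k, ?_⟩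
  have := hρ.1.trace_eq_sum_eigenvalues
  rw [ht] at this
  have h2 := congrArg Complex.re this
  simpa [Complex.re_sum] using h2.symm

lemma vN_nonneg {d : ℕ} {ρ : Matrix (Fin d) (Fin d) ℂ} (hρ : ρ.PosSemidef) (ht : ρ.trace = 1) :
    0 ≤ vonNeumannEntropy ρ := by
  obtain ⟨h0, h1⟩ := eig_facts hρ ht
  rw [vonNeumannEntropy, dif_pos hρ.1, ← Finset.sum_neg_distrib]
  refine Finset.sum_nonneg fun k _ => ?_
  have hle : hρ.1.eigenvalues k ≤ 1 := by
    rw [← h1]; exact Finset.single_le_sum (fun k _ => h0 k) (Finset.mem_univ k)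
  have := mul_nonneg (h0 k) (neg_nonneg.2 (Real.log_nonpos (h0 k) hle))
  linarith

lemma single {n n' d : ℕ} {X : Fin n → Matrix (Fin d) (Fin d) ℂ}
    {Y : Fin n' → Matrix (Fin d) (Fin d) ℂ} (hX : IsPM X) (hY : IsPM Y)
    (C : Matrix (Fin n) (Fin n') ℝ) (hC : ∀ i j, (C i j : ℂ) = (X i * Y j).trace)
    {ρ : Matrix (Fin d) (Fin d) ℂ} (hρ : ρ.PosSemidef) (ht : ρ.trace = 1)
    (μ lam : ℝ) (hμ0 : 0 < μ) (hlam0 : 0 ≤ lam) (hlam1 : lam < 1) :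
    vonNeumannEntropy ρ - Real.log (matPNorm (1 / μ) (1 / (1 - lam)) (C.map Complex.ofReal))
      ≤ lam * shannonEntropy (fun i => (ρ * X i).trace.re)
        + μ * shannonEntropy (fun j => (ρ * Y j).trace.re) := by
  obtain ⟨h0, h1⟩ := eig_facts hρ ht
  obtain ⟨r, hr⟩ : ∃ r, r = hρ.1.eigenvalues := ⟨_, rfl⟩
  obtain ⟨V, hVdef⟩ : ∃ V : Matrix (Fin d) (Fin d) ℂ, V = hρ.1.eigenvectorUnitary := ⟨_, rfl⟩
  have hV : V * Vᴴ = 1 := by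
    rw [hVdef, ← star_eq_conjTranspose]; exact Unitary.coe_mul_star_self _
  have hV' : Vᴴ * V = 1 := by
    rw [hVdef, ← star_eq_conjTranspose]; exact Unitary.coe_star_mul_self _
  have hsp : ρ = V * diagonal (fun k => (r k : ℂ)) * Vᴴ := by
    have := hρ.1.spectral_theorem
    rw [Unitary.conjStarAlgAut_apply] at this
    rw [hVdef, hr]
    exact this
  have htr : ∀ Z : Matrix (Fin d) (Fin d) ℂ, (ρ * Z).trace.re = ∑ k, r k * ((Vᴴ * Z * V) k k).re := by
    intro Z
    have : (ρ * Z).trace = (diagonal (fun k => (r k : ℂ)) * (Vᴴ * Z * V)).trace := by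
      rw [hsp, mul_assoc, mul_assoc, Matrix.trace_mul_comm]; simp only [mul_assoc]
    rw [this, Matrix.trace, Complex.re_sum]
    simp [diagonal_mul]
  have htr2 : ∀ i j, (Vᴴ * X i * V * (Vᴴ * Y j * V)).trace.re = C i j := by
    intro i j
    have : Vᴴ * X i * V * (Vᴴ * Y j * V) = Vᴴ * (X i * Y j * V) := by
      calc _ = Vᴴ * X i * (V * Vᴴ) * Y j * V := by simp only [mul_assoc]
        _ = _ := by rw [hV]; simp only [mul_assoc, one_mul]
    rw [this, Matrix.trace_mul_comm, mul_assoc, hV, mul_one, ← hC, Complex.ofReal_re]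
  have hX' := hX.conj V hV hV'
  have hY' := hY.conj V hV hV'
  rw [← hr] at h0 h1
  have hCnn : ∀ i j, 0 ≤ C i j := fun i j => by
    rw [← htr2]; exact hX'.tr_nonneg hY' i j
  obtain ⟨p, hp⟩ : ∃ p : Fin n → ℝ, p = fun i => (ρ * X i).trace.re := ⟨_, rfl⟩
  obtain ⟨q, hq⟩ : ∃ q : Fin n' → ℝ, q = fun j => (ρ * Y j).trace.re := ⟨_, rfl⟩
  have hpj : ∀ i, p i = ∑ k, r k * ((Vᴴ * X i * V) k k).re := fun i => by rw [hp]; exact htr _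
  have hqj : ∀ j, q j = ∑ k, r k * ((Vᴴ * Y j * V) k k).re := fun j => by rw [hq]; exact htr _
  obtain ⟨hp0, hp1, -⟩ := single_diag hX' hX' r h0 h1 (fun _ => 1) (fun _ => one_pos) p hpj 1
  obtain ⟨hq0, hq1, -⟩ := single_diag hX' hY' r h0 h1 (fun _ => 1) (fun _ => one_pos) q hqj 1
  have hN := norm_bound C hCnn p hp0 hp1 q hq0 hq1 μ lam hμ0 hlam0 hlam1
  have hS : vonNeumannEntropy ρ = -∑ k, r k * Real.log (r k) := by
    rw [vonNeumannEntropy, dif_pos hρ.1, hr]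
  rw [← hp, ← hq, hS]
  obtain ⟨L, hL⟩ : ∃ L, L = lam * shannonEntropy p + μ * shannonEntropy q
    + ∑ k, r k * Real.log (r k) := ⟨_, rfl⟩
  have hexp : ∀ e : ℝ, 0 < e → Real.exp (-L) ≤ ∑ j, (∑ i, (p i ^ lam + e) * C i j) * q j ^ μ := by
    intro e he
    obtain ⟨-, -, h⟩ := single_diag hX' hY' r h0 h1 (fun i => p i ^ lam + e)
      (fun i => by have := Real.rpow_nonneg (hp0 i) lam; positivity) q hqj μ
    simp only [htr2, ← hpj] at h
    refine le_trans (Real.exp_le_exp.2 (neg_le_neg ?_)) h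
    rw [hL, shannonEntropy, shannonEntropy]
    have : lam * ∑ i, p i * Real.log (p i) ≤ ∑ i, p i * Real.log (p i ^ lam + e) := by
      rw [Finset.mul_sum]
      refine Finset.sum_le_sum fun i _ => ?_
      rcases (hp0 i).eq_or_lt with h | h
      · simp [← h]
      · have h2 := Real.log_le_log (Real.rpow_pos_of_pos h lam) 
          (show p i ^ lam ≤ p i ^ lam + e by linarith)
        rw [Real.log_rpow h] at h2
        nlinarith [mul_le_mul_of_nonneg_left h2 h.le]
    linarith
  have hlim : Real.exp (-L) ≤ ∑ j, (∑ i, p i ^ lam * C i j) * q j ^ μ := by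
    have hc : Continuous fun e : ℝ => ∑ j, (∑ i, (p i ^ lam + e) * C i j) * q j ^ μ := by fun_prop
    have h2 := (hc.tendsto 0).mono_left (nhdsWithin_le_nhds (s := Set.Ioi 0))
    simp only [add_zero] at h2
    exact ge_of_tendsto h2 (Filter.eventually_of_mem self_mem_nhdsWithin fun e he => hexp e he)
  have h3 := hlim.trans hN
  have h4 := (Real.le_log_iff_exp_le ((Real.exp_pos _).trans_le h3)).2 h3
  linarith

lemma tr_facts {n d : ℕ} {X : Fin n → Matrix (Fin d) (Fin d) ℂ} (hX : IsPM X)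
    {ρ : Matrix (Fin d) (Fin d) ℂ} (hρ : ρ.PosSemidef) (ht : ρ.trace = 1) :
    (∀ i, 0 ≤ (ρ * X i).trace) ∧ ∑ i, (ρ * X i).trace.re = 1 := by
  constructor
  · intro i
    have h1 := (hρ.conjTranspose_mul_mul_same (X i)).trace_nonneg
    rwa [(hX.herm i).eq, Matrix.trace_mul_comm, ← mul_assoc, hX.proj, Matrix.trace_mul_comm] at h1
  · rw [← Complex.re_sum, ← trace_sum, ← Finset.mul_sum, hX.sum, mul_one, ht]; simp

lemma joint_entropy {n n' d d' m : ℕ} {X : Fin n → Matrix (Fin d) (Fin d) ℂ}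
    {Y : Fin n' → Matrix (Fin d') (Fin d') ℂ} (hX : IsPM X) (hY : IsPM Y)
    (p : Fin m → ℝ) (hp : ∀ i, 0 ≤ p i) 
    (ρA : Fin m → Matrix (Fin d) (Fin d) ℂ)
    (hρA : ∀ i, (ρA i).PosSemidef ∧ (ρA i).trace = 1)
    (ρB : Fin m → Matrix (Fin d') (Fin d') ℂ)
    (hρB : ∀ i, (ρB i).PosSemidef ∧ (ρB i).trace = 1) :
    (shannonEntropy (fun x => ((∑ i, (p i : ℂ) • ρA i) * X x).trace.re)
      + ∑ i, p i * shannonEntropy (fun y => (ρB i * Y y).trace.re)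
      ≤ shannonEntropy (fun ik : Fin n × Fin n' =>
        (((∑ i, (p i : ℂ) • (ρA i ⊗ₖ ρB i)) * (X ik.1 ⊗ₖ Y ik.2)).trace).re)) ∧
    (shannonEntropy (fun y => ((∑ i, (p i : ℂ) • ρB i) * Y y).trace.re)
      + ∑ i, p i * shannonEntropy (fun x => (ρA i * X x).trace.re)
      ≤ shannonEntropy (fun ik : Fin n × Fin n' =>
        (((∑ i, (p i : ℂ) • (ρA i ⊗ₖ ρB i)) * (X ik.1 ⊗ₖ Y ik.2)).trace).re)) := by
  obtain ⟨a, ha⟩ : ∃ a : Fin m → Fin n → ℝ, ∀ i x, a i x = (ρA i * X x).trace.re :=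
    ⟨_, fun _ _ => rfl⟩
  obtain ⟨b, hb⟩ : ∃ b : Fin m → Fin n' → ℝ, ∀ i x, b i x = (ρB i * Y x).trace.re :=
    ⟨_, fun _ _ => rfl⟩
  have fA := fun i => tr_facts hX (hρA i).1 (hρA i).2
  have fB := fun i => tr_facts hY (hρB i).1 (hρB i).2
  have ha0 : ∀ i x, 0 ≤ a i x := fun i x => by rw [ha]; exact (Complex.le_def.1 ((fA i).1 x)).1
  have hb0 : ∀ i x, 0 ≤ b i x := fun i x => by rw [hb]; exact (Complex.le_def.1 ((fB i).1 x)).1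
  have ha1 : ∀ i, ∑ x, a i x = 1 := fun i => by simp only [ha]; exact (fA i).2
  have hb1 : ∀ i, ∑ x, b i x = 1 := fun i => by simp only [hb]; exact (fB i).2
  have eA : ∀ x, ((∑ i, (p i : ℂ) • ρA i) * X x).trace.re = ∑ i, p i * a i x := by
    intro x
    simp only [Finset.sum_mul, trace_sum, Complex.re_sum, smul_mul_assoc, trace_smul, smul_eq_mul,
      Complex.re_ofReal_mul, ha]
  have eB : ∀ x, ((∑ i, (p i : ℂ) • ρB i) * Y x).trace.re = ∑ i, p i * b i x := by
    intro x
    simp only [Finset.sum_mul, trace_sum, Complex.re_sum, smul_mul_assoc, trace_smul, smul_eq_mul,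
      Complex.re_ofReal_mul, hb]
  have eAB : ∀ ik : Fin n × Fin n', (((∑ i, (p i : ℂ) • (ρA i ⊗ₖ ρB i)) * (X ik.1 ⊗ₖ Y ik.2)).trace).re
      = ∑ i, p i * (a i ik.1 * b i ik.2) := by
    intro ik
    simp only [Finset.sum_mul, trace_sum, Complex.re_sum, smul_mul_assoc, trace_smul, smul_eq_mul,
      Complex.re_ofReal_mul, ha, hb, ← mul_kronecker_mul, trace_kronecker]
    refine Finset.sum_congr rfl fun i _ => ?_
    have := (Complex.le_def.1 ((fA i).1 ik.1)).2
    simp only [Complex.zero_im] at this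
    rw [Complex.mul_re, ← this]; ring
  simp only [eA, eB, eAB, ← ha, ← hb]
  refine ⟨chain p a b hp ha0 hb0 ha1 hb1, ?_⟩
  refine (chain p b a hp hb0 ha0 hb1 ha1).trans (le_of_eq ?_)
  rw [hsh, hsh]
  refine Fintype.sum_equiv (Equiv.prodComm _ _) _ _ fun xy => ?_
  simp [mul_comm]

lemma mix {d m : ℕ} (p : Fin m → ℝ) (hp : ∀ i, 0 ≤ p i) (hpsum : ∑ i, p i = 1)
    (ρ : Fin m → Matrix (Fin d) (Fin d) ℂ)
    (hρ : ∀ i, (ρ i).PosSemidef ∧ (ρ i).trace = 1) :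
    (∑ i, (p i : ℂ) • ρ i).PosSemidef ∧ (∑ i, (p i : ℂ) • ρ i).trace = 1 := by
  constructor
  · refine posSemidef_sum _ fun i _ => (hρ i).1.smul ?_
    exact_mod_cast hp i
  · simp only [trace_sum, trace_smul, (hρ _).2, smul_eq_mul, mul_one]
    exact_mod_cast hpsum

lemma avg {m : ℕ} (p f : Fin m → ℝ) (hp : ∀ i, 0 ≤ p i) (hpsum : ∑ i, p i = 1) (c : ℝ)
    (h : ∀ i, c ≤ f i) : c ≤ ∑ i, p i * f i := by
  calc c = ∑ i, p i * c := by rw [← Finset.sum_mul, hpsum, one_mul]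
    _ ≤ _ := Finset.sum_le_sum fun i _ => mul_le_mul_of_nonneg_left (h i) (hp i)

end SepUR


/-- **Uncertainty relation for separable states.** For local projective measurements
`X_A, Y_A` on `ℂ^{d_A}` and `X_B, Y_B` on `ℂ^{d_B}` with overlap matrices `C_A, C_B`, the
product measurements `X_{AB} = X_A ⊗ X_B`, `Y_{AB} = Y_A ⊗ Y_B`, any separable state
`ρ_{AB} = ∑ᵢ pᵢ ρᵢᴬ ⊗ ρᵢᴮ`, and parameters `0 < μ ≤ 1`, `0 ≤ λ < 1`:
`λ H(X_{AB}) + μ H(Y_{AB}) ≥ max(S(ρ_A), S(ρ_B)) - log ‖C_A‖ - log ‖C_B‖`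
with norms `‖·‖_{(1/μ)→(1/(1-λ))}`. -/
theorem separable_uncertainty_relation {dA dB nXA nYA nXB nYB m : ℕ}
    (XA : Fin nXA → Matrix (Fin dA) (Fin dA) ℂ)
    (YA : Fin nYA → Matrix (Fin dA) (Fin dA) ℂ)
    (XB : Fin nXB → Matrix (Fin dB) (Fin dB) ℂ)
    (YB : Fin nYB → Matrix (Fin dB) (Fin dB) ℂ)
    (hXAherm : ∀ i, (XA i).IsHermitian) (hXAproj : ∀ i, XA i * XA i = XA i)
    (hXAorth : ∀ i j, i ≠ j → XA i * XA j = 0) (hXAsum : ∑ i, XA i = 1)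
    (hYAherm : ∀ i, (YA i).IsHermitian) (hYAproj : ∀ i, YA i * YA i = YA i)
    (hYAorth : ∀ i j, i ≠ j → YA i * YA j = 0) (hYAsum : ∑ i, YA i = 1)
    (hXBherm : ∀ i, (XB i).IsHermitian) (hXBproj : ∀ i, XB i * XB i = XB i)
    (hXBorth : ∀ i j, i ≠ j → XB i * XB j = 0) (hXBsum : ∑ i, XB i = 1)
    (hYBherm : ∀ i, (YB i).IsHermitian) (hYBproj : ∀ i, YB i * YB i = YB i)
    (hYBorth : ∀ i j, i ≠ j → YB i * YB j = 0) (hYBsum : ∑ i, YB i = 1)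
    (CA : Matrix (Fin nXA) (Fin nYA) ℝ)
    (hCA : ∀ i j, (CA i j : ℂ) = (XA i * YA j).trace)
    (CB : Matrix (Fin nXB) (Fin nYB) ℝ)
    (hCB : ∀ k l, (CB k l : ℂ) = (XB k * YB l).trace)
    (p : Fin m → ℝ) (hp : ∀ i, 0 ≤ p i) (hpsum : ∑ i, p i = 1)
    (ρA : Fin m → Matrix (Fin dA) (Fin dA) ℂ)
    (hρA : ∀ i, (ρA i).PosSemidef ∧ (ρA i).trace = 1)
    (ρB : Fin m → Matrix (Fin dB) (Fin dB) ℂ)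
    (hρB : ∀ i, (ρB i).PosSemidef ∧ (ρB i).trace = 1)
    (ρAB : Matrix (Fin dA × Fin dB) (Fin dA × Fin dB) ℂ)
    (hρAB : ρAB = ∑ i, (p i : ℂ) • (ρA i ⊗ₖ ρB i))
    (μ lam : ℝ) (hμ0 : 0 < μ) (hμ1 : μ ≤ 1) (hlam0 : 0 ≤ lam) (hlam1 : lam < 1) :
    lam * shannonEntropy (fun ik : Fin nXA × Fin nXB =>
        ((ρAB * (XA ik.1 ⊗ₖ XB ik.2)).trace).re)
      + μ * shannonEntropy (fun jl : Fin nYA × Fin nYB =>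
        ((ρAB * (YA jl.1 ⊗ₖ YB jl.2)).trace).re)
    ≥ max (vonNeumannEntropy (∑ i, (p i : ℂ) • ρA i))
          (vonNeumannEntropy (∑ i, (p i : ℂ) • ρB i))
      - Real.log (matPNorm (1 / μ) (1 / (1 - lam)) (CA.map Complex.ofReal))
      - Real.log (matPNorm (1 / μ) (1 / (1 - lam)) (CB.map Complex.ofReal)) := by
  have hXA : SepUR.IsPM XA := ⟨hXAherm, hXAproj, hXAorth, hXAsum⟩
  have hYA : SepUR.IsPM YA := ⟨hYAherm, hYAproj, hYAorth, hYAsum⟩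
  have hXB : SepUR.IsPM XB := ⟨hXBherm, hXBproj, hXBorth, hXBsum⟩
  have hYB : SepUR.IsPM YB := ⟨hYBherm, hYBproj, hYBorth, hYBsum⟩
  obtain ⟨x1, x2⟩ := SepUR.joint_entropy hXA hXB p hp ρA hρA ρB hρB
  obtain ⟨y1, y2⟩ := SepUR.joint_entropy hYA hYB p hp ρA hρA ρB hρB
  rw [← hρAB] at x1 x2 y1 y2
  obtain ⟨mA1, mA2⟩ := SepUR.mix p hp hpsum ρA hρA
  obtain ⟨mB1, mB2⟩ := SepUR.mix p hp hpsum ρB hρB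
  have sA := SepUR.single hXA hYA CA hCA mA1 mA2 μ lam hμ0 hlam0 hlam1
  have sB := SepUR.single hXB hYB CB hCB mB1 mB2 μ lam hμ0 hlam0 hlam1
  have aA := SepUR.avg p _ hp hpsum _ fun i => (sub_le_sub_right (SepUR.vN_nonneg (hρA i).1 (hρA i).2)
    _).trans (SepUR.single hXA hYA CA hCA (hρA i).1 (hρA i).2 μ lam hμ0 hlam0 hlam1)
  have aB := SepUR.avg p _ hp hpsum _ fun i => (sub_le_sub_right (SepUR.vN_nonneg (hρB i).1 (hρB i).2)
    _).trans (SepUR.single hXB hYB CB hCB (hρB i).1 (hρB i).2 μ lam hμ0 hlam0 hlam1)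
  simp only [mul_add, Finset.sum_add_distrib, mul_left_comm _ lam, mul_left_comm _ μ,
    ← Finset.mul_sum] at aA aB
  have x1' := mul_le_mul_of_nonneg_left x1 hlam0
  have x2' := mul_le_mul_of_nonneg_left x2 hlam0
  have y1' := mul_le_mul_of_nonneg_left y1 hμ0.le
  have y2' := mul_le_mul_of_nonneg_left y2 hμ0.le
  rw [mul_add] at x1' x2' y1' y2'
  rw [ge_iff_le, sub_sub, sub_le_iff_le_add]
  apply max_le
  · linarith
  · linarith
end
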